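/- arXiv:2108.10384 — 2 statements merged into one kernel-verified Lean document; each statement's English description precedes it below -/
import Mathlib

section
/- Let G = C_{q₁} × C_{q₂}, where q₁ ≤ q₂ are prime powers. If G is not cyclic of order p^k or 2p for a prime p and positive integer k (with |G| ≠ 2), and G is not isomorphic to one of the groups C₁₂, C₁₅, C₂₀, C₂₁, C₂×C₄, C₃×C₃, C₄×C₄, C₅×C₅, then α(G) ≤ |G|. Conversely, if G is cyclic of order p^k or 2p (|G| ≠ 2) or isomorphic to one of these 8 groups, then α(G) > |G|. -/
/-- `graphAlpha G` is the minimum number of vertices of a finite simple graph whose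
automorphism group is isomorphic to `G`. -/
noncomputable def graphAlpha (G : Type*) [Group G] : ℕ :=
  sInf {n : ℕ | ∃ Γ : SimpleGraph (Fin n), Nonempty ((Γ ≃g Γ) ≃* G)}

/-- The cyclic group of order `n`. -/
abbrev Cyc (n : ℕ) := Multiplicative (ZMod n)

/-- `G` is cyclic of order `p ^ k` or `2 * p` for a prime `p` and positive
integer `k`, with `|G| ≠ 2`. -/
def ExcCyclic (G : Type*) [Group G] : Prop :=
  IsCyclic G ∧ Nat.card G ≠ 2 ∧
    ((∃ p k : ℕ, p.Prime ∧ 0 < k ∧ Nat.card G = p ^ k) ∨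
      (∃ p : ℕ, p.Prime ∧ Nat.card G = 2 * p))

/-- The 8 exceptional groups `C₁₂, C₁₅, C₂₀, C₂₁, C₂×C₄, C₃×C₃, C₄×C₄, C₅×C₅`. -/
def ExcEight (G : Type*) [Group G] : Prop :=
  Nonempty (G ≃* Cyc 12) ∨ Nonempty (G ≃* Cyc 15) ∨
  Nonempty (G ≃* Cyc 20) ∨ Nonempty (G ≃* Cyc 21) ∨
  Nonempty (G ≃* Multiplicative (ZMod 2 × ZMod 4)) ∨
  Nonempty (G ≃* Multiplicative (ZMod 3 × ZMod 3)) ∨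
  Nonempty (G ≃* Multiplicative (ZMod 4 × ZMod 4)) ∨
  Nonempty (G ≃* Multiplicative (ZMod 5 × ZMod 5))

/-- Conjugation by a graph isomorphism identifies automorphism groups. -/
def autCongr {V W : Type*} {Γ : SimpleGraph V} {Δ : SimpleGraph W} (e : Γ ≃g Δ) :
    (Γ ≃g Γ) ≃* (Δ ≃g Δ) where
  toFun f := (e.symm.trans f).trans e
  invFun f := (e.trans f).trans e.symm
  left_inv f := by ext; simp
  right_inv f := by ext; simp
  map_mul' f g := by ext; simp [RelIso.mul_apply]

/-- A graph and its complement have the same automorphisms. -/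
def autCompl {V : Type*} (Γ : SimpleGraph V) : (Γ ≃g Γ) ≃* (Γᶜ ≃g Γᶜ) where
  toFun f := ⟨f.toEquiv, by simp [SimpleGraph.compl_adj, f.map_adj_iff]⟩
  invFun f := ⟨f.toEquiv, fun {a b} ↦ by
    have h := f.map_rel_iff (a := a) (b := b)
    by_cases hab : a = b
    · simp [hab]
    · simpa [SimpleGraph.compl_adj, hab, not_iff_not] using h⟩
  left_inv _ := rfl
  right_inv _ := rfl
  map_mul' _ _ := rfl

/-- If every automorphism of a disjoint sum preserves the left summand, then the automorphism
group is the product of those of the summands. -/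
lemma nonempty_aut_sum_mulEquiv {V W : Type*} [Finite V]
    {Γ : SimpleGraph V} {Δ : SimpleGraph W}
    (h : ∀ f : (Γ ⊕g Δ) ≃g (Γ ⊕g Δ), ∀ v, ∃ v', f (.inl v) = .inl v') :
    Nonempty (((Γ ⊕g Δ) ≃g (Γ ⊕g Δ)) ≃* (Γ ≃g Γ) × (Δ ≃g Δ)) := by
  let φ : (Γ ≃g Γ) × (Δ ≃g Δ) →* ((Γ ⊕g Δ) ≃g (Γ ⊕g Δ)) :=
    { toFun p := SimpleGraph.Iso.sumCongr p.1 p.2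
      map_one' := by ext (_ | _) <;> rfl
      map_mul' p q := by ext (_ | _) <;> rfl }
  refine ⟨(MulEquiv.ofBijective φ ⟨fun p q hpq ↦ ?_, fun f ↦ ?_⟩).symm⟩
  · have hv (x) : φ p x = φ q x := by rw [hpq]
    refine Prod.ext (RelIso.ext fun v ↦ ?_) (RelIso.ext fun w ↦ ?_)
    · simpa [φ] using hv (.inl v)
    · simpa [φ] using hv (.inr w)
  · choose a ha using h f
    have ainj : Function.Injective a := fun v v' hv ↦ by
      have := ha v
      rw [hv, ← ha v'] at this
      simpa using this
    have asurj := Finite.surjective_of_injective ainj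
    have hr (w) : ∃ w', f (.inr w) = .inr w' := by
      rcases hw : f (.inr w) with v | w'
      · obtain ⟨v', rfl⟩ := asurj v
        rw [← ha v'] at hw
        simp at hw
      · exact ⟨w', rfl⟩
    choose b hb using hr
    have binj : Function.Injective b := fun v v' hv ↦ by
      have := hb v
      rw [hv, ← hb v'] at this
      simpa using this
    have bsurj : Function.Surjective b := fun w ↦ by
      obtain ⟨x | x, hx⟩ := f.surjective (.inr w)
      · simp [ha] at hx
      · exact ⟨x, by simpa [hb] using hx⟩
    refine ⟨⟨⟨Equiv.ofBijective a ⟨ainj, asurj⟩, fun {v v'} ↦ ?_⟩,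
      ⟨Equiv.ofBijective b ⟨binj, bsurj⟩, fun {v v'} ↦ ?_⟩⟩, ?_⟩
    · change Γ.Adj (a v) (a v') ↔ _
      simpa [ha] using f.map_adj_iff (v := .inl v) (w := .inl v')
    · change Δ.Adj (b v) (b v') ↔ _
      simpa [hb] using f.map_adj_iff (v := .inr v) (w := .inr v')
    · ext (x | x)
      · exact (ha x).symm
      · exact (hb x).symm

lemma sum_aut_preserves_left {V W : Type*} [Finite V] [Finite W]
    {Γ : SimpleGraph V} {Δ : SimpleGraph W} (hΓ : Γ.Connected) (hΔ : Δ.Connected)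
    (hcard : Nat.card V ≠ Nat.card W) (f : (Γ ⊕g Δ) ≃g (Γ ⊕g Δ)) (v : V) :
    ∃ v', f (.inl v) = .inl v' := by
  have hVV (f : (Γ ⊕g Δ) ≃g (Γ ⊕g Δ)) (v v') :
      (f (.inl v)).isLeft = (f (.inl v')).isLeft := by
    have h := ((hΓ.preconnected v v').map SimpleGraph.Embedding.sumInl.toHom).map f.toHom
    rcases h1 : f (.inl v) with x | x <;> rcases h2 : f (.inl v') with y | y <;> simp
    · exact SimpleGraph.not_reachable_sum_inl_inr x y (by simpa [h1, h2] using h)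
    · exact SimpleGraph.not_reachable_sum_inl_inr y x (by simpa [h1, h2] using h.symm)
  have hWW (f : (Γ ⊕g Δ) ≃g (Γ ⊕g Δ)) (v v') :
      (f (.inr v)).isLeft = (f (.inr v')).isLeft := by
    have h := ((hΔ.preconnected v v').map SimpleGraph.Embedding.sumInr.toHom).map f.toHom
    rcases h1 : f (.inr v) with x | x <;> rcases h2 : f (.inr v') with y | y <;> simp
    · exact SimpleGraph.not_reachable_sum_inl_inr x y (by simpa [h1, h2] using h)
    · exact SimpleGraph.not_reachable_sum_inl_inr y x (by simpa [h1, h2] using h.symm)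
  rcases hv : f (.inl v) with v' | w
  · exact ⟨v', rfl⟩
  exfalso
  have hl (x) : ∃ y, f (.inl x) = .inr y := by
    have := hVV f x v
    rw [hv] at this
    rcases h : f (.inl x) with z | z
    · simp [h] at this
    · exact ⟨z, rfl⟩
  have hr (x) : ∃ y, f (.inr x) = .inl y := by
    obtain ⟨x₀ | x₀, h₀⟩ := f.surjective (.inl v)
    · obtain ⟨y, hy⟩ := hl x₀
      simp [hy] at h₀
    · have := hWW f x x₀
      rw [h₀] at this
      rcases h : f (.inr x) with z | z
      · exact ⟨z, rfl⟩
      · simp [h] at this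
  choose a ha using hl
  choose b hb using hr
  have ainj : Function.Injective a := fun v v' hv ↦ by
    have := ha v
    rw [hv, ← ha v'] at this
    simpa using this
  have binj : Function.Injective b := fun v v' hv ↦ by
    have := hb v
    rw [hv, ← hb v'] at this
    simpa using this
  exact hcard (le_antisymm (Nat.card_le_card_of_injective a ainj)
    (Nat.card_le_card_of_injective b binj))

/-- `G` is the automorphism group of a connected graph on `n` vertices. -/
def ConnRealizes (n : ℕ) (G : Type*) [Group G] : Prop :=
  ∃ Γ : SimpleGraph (Fin n), Γ.Connected ∧ Nonempty ((Γ ≃g Γ) ≃* G)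

/-- `G` is the automorphism group of a graph on `n` vertices. -/
def Realizes (n : ℕ) (G : Type*) [Group G] : Prop :=
  ∃ Γ : SimpleGraph (Fin n), Nonempty ((Γ ≃g Γ) ≃* G)

lemma Realizes.of_graph {V G : Type*} [Fintype V] [Group G] (Γ : SimpleGraph V)
    (e : (Γ ≃g Γ) ≃* G) : Realizes (Fintype.card V) G :=
  ⟨_, ⟨(autCongr (Γ.overFinIso rfl)).symm.trans e⟩⟩

lemma ConnRealizes.of_graph {V G : Type*} [Fintype V] [Group G] (Γ : SimpleGraph V)
    (hΓ : Γ.Connected) (e : (Γ ≃g Γ) ≃* G) : ConnRealizes (Fintype.card V) G :=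
  ⟨_, (Γ.overFinIso rfl).connected_iff.1 hΓ, ⟨(autCongr (Γ.overFinIso rfl)).symm.trans e⟩⟩

lemma ConnRealizes.prod {m n : ℕ} {G H : Type*} [Group G] [Group H]
    (hG : ConnRealizes m G) (hH : ConnRealizes n H) (hmn : m ≠ n) : Realizes (m + n) (G × H) := by
  obtain ⟨Γ, hΓ, ⟨e⟩⟩ := hG
  obtain ⟨Δ, hΔ, ⟨e'⟩⟩ := hH
  obtain ⟨φ⟩ := nonempty_aut_sum_mulEquiv
    (sum_aut_preserves_left hΓ hΔ (by simpa using hmn))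
  simpa using Realizes.of_graph _ (φ.trans (e.prodCongr e'))

lemma ConnRealizes.succ {n : ℕ} {G : Type*} [Group G] (hn : 2 ≤ n)
    (hG : ConnRealizes n G) : ConnRealizes (n + 1) G := by
  obtain ⟨Γ, hΓ, ⟨e⟩⟩ := hG
  let Δ : SimpleGraph (Fin 1) := ⊥
  have hΔ : Δ.Connected := { preconnected := .of_subsingleton, nonempty := inferInstance }
  have : Nonempty (Fin n) := ⟨⟨0, by omega⟩⟩
  obtain ⟨φ⟩ := nonempty_aut_sum_mulEquiv
    (sum_aut_preserves_left hΓ hΔ (by simp; omega))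
  let : Unique (Δ ≃g Δ) := ⟨⟨1⟩, fun f ↦ by ext x; simp⟩
  simpa using ConnRealizes.of_graph (Γ ⊕g Δ)ᶜ
    ((SimpleGraph.connected_or_connected_compl _).resolve_left SimpleGraph.not_connected_sum)
    ((autCompl _).symm.trans (φ.trans (MulEquiv.prodUnique.trans e)))

lemma Realizes.graphAlpha_le {n : ℕ} {G : Type*} [Group G] (h : Realizes n G) :
    graphAlpha G ≤ n := Nat.sInf_le h

lemma Realizes.congr {n : ℕ} {G H : Type*} [Group G] [Group H] (h : Realizes n G) (e : G ≃* H) :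
    Realizes n H := by
  obtain ⟨Γ, ⟨φ⟩⟩ := h
  exact ⟨Γ, ⟨φ.trans e⟩⟩

/-- Suppose that a graph carries an action of `ZMod q` by automorphisms, together with an
equivariantly embedded `q`-cycle that every automorphism preserves. If no nontrivial automorphism
fixes the cycle pointwise and none reflects it, then all automorphisms come from the action. -/
lemma nonempty_aut_mulEquiv_zmod {V : Type*} {q : ℕ} {Γ : SimpleGraph V}
    (α : ZMod q → V) (hα : Function.Injective α)
    (hadj : ∀ i j, Γ.Adj (α i) (α j) ↔ i ≠ j ∧ (j = i + 1 ∨ i = j + 1))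
    (φ : Multiplicative (ZMod q) →* (Γ ≃g Γ)) (hφ : ∀ t i, φ (.ofAdd t) (α i) = α (t + i))
    (hcycle : ∀ (f : Γ ≃g Γ) i, ∃ j, f (α i) = α j)
    (hfix : ∀ f : Γ ≃g Γ, (∀ i, f (α i) = α i) → f = 1)
    (hrefl : ∀ f : Γ ≃g Γ, ¬ ∀ i, f (α i) = α (-i)) [NeZero q] :
    Nonempty ((Γ ≃g Γ) ≃* Multiplicative (ZMod q)) := by
  refine ⟨(MulEquiv.ofBijective φ ⟨(injective_iff_map_eq_one φ).2 fun t ht ↦ ?_, fun f ↦ ?_⟩).symm⟩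
  · have := hφ t.toAdd 0
    rw [ofAdd_toAdd, ht, RelIso.one_apply] at this
    simpa using (hα this).symm
  · obtain ⟨t, ht⟩ := hcycle f 0
    suffices h : φ (.ofAdd (-t)) * f = 1 by
      refine ⟨.ofAdd t, ?_⟩
      rw [ofAdd_neg, map_inv, inv_mul_eq_one] at h
      exact h
    set g := φ (.ofAdd (-t)) * f with hg
    have hg0 : g (α 0) = α 0 := by rw [hg, RelIso.mul_apply, ht, hφ]; simp
    choose β hβ using hcycle g
    have hβadj (i j) : (β i ≠ β j ∧ (β j = β i + 1 ∨ β i = β j + 1)) ↔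
        (i ≠ j ∧ (j = i + 1 ∨ i = j + 1)) := by
      rw [← hadj, ← hadj, ← hβ, ← hβ, g.map_adj_iff]
    have hβinj : Function.Injective β := fun i j hij ↦ by
      have := hβ i
      rw [hij, ← hβ j] at this
      exact hα (g.injective this)
    have hβ0 : β 0 = 0 := hα (by rw [← hβ, hg0])
    have key (s : ZMod q) (hs : s = 1 ∨ s = -1) (h1 : β 1 = s) (n : ℕ) :
        β n = s * n ∧ β (n + 1) = s * (n + 1) := by
      induction n with
      | zero => simp [hβ0, h1]
      | succ n ih =>
        refine ⟨by simpa using ih.2, ?_⟩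
        push_cast
        by_cases h2 : ((n : ZMod q) + 1 + 1) = n + 1
        · rw [h2, ih.2]
        have h3 := (hβadj (n + 1) (n + 1 + 1)).2 ⟨Ne.symm h2, by simp⟩
        by_cases h4 : ((n : ZMod q) + 1 + 1) = n
        · rw [h4, ih.1]
        have h5 : β (n + 1 + 1) ≠ β n := fun h ↦ h4 (hβinj h)
        rw [ih.1] at h5
        rw [ih.2] at h3
        grind
    have h1 : β 1 = 1 ∨ β 1 = -1 := by
      by_cases h : (1 : ZMod q) = 0
      · rw [h, hβ0]; simp
      · have := (hβadj 0 1).2 ⟨Ne.symm h, by simp⟩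
        rw [hβ0] at this
        grind
    have hall (i : ZMod q) (s : ZMod q) (hs : s = 1 ∨ s = -1) (h1 : β 1 = s) : β i = s * i := by
      have := (key s hs h1 i.val).1
      rwa [ZMod.natCast_zmod_val] at this
    rcases h1 with h1 | h1
    · exact hfix g fun i ↦ by rw [hβ, hall i 1 (.inl rfl) h1, one_mul]
    · exact (hrefl g fun i ↦ by rw [hβ, hall i _ (.inr rfl) h1, neg_one_mul]).elim

/-- Consider a graph consisting of a `q`-cycle and further vertices, with a rotation action of
`ZMod q`. If no automorphism moves the cycle outside itself, the vertices outside the cycle are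
nonempty and determined by their neighbors on the cycle, and no automorphism reflects the cycle,
then the automorphism group is cyclic of order `q`. -/
lemma ConnRealizes.of_cycle {q : ℕ} [NeZero q] {W : Type*} [Fintype W]
    (Γ : SimpleGraph (ZMod q ⊕ W)) (act : ZMod q → W → W)
    (act_zero : ∀ w, act 0 w = w) (act_add : ∀ s t w, act (s + t) w = act s (act t w))
    (hadj : ∀ i j, Γ.Adj (.inl i) (.inl j) ↔ i ≠ j ∧ (j = i + 1 ∨ i = j + 1))
    (hact : ∀ t v w, Γ.Adj v w → Γ.Adj (Sum.map (t + ·) (act t) v) (Sum.map (t + ·) (act t) w))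
    (hcycle : ∀ (f : Γ ≃g Γ) i w, f (.inl i) ≠ .inr w)
    (hne : ∀ w, ∃ i, Γ.Adj (.inl i) (.inr w))
    (htrace : ∀ w w', (∀ i, Γ.Adj (.inl i) (.inr w) ↔ Γ.Adj (.inl i) (.inr w')) → w = w')
    (hrefl : ∀ f : Γ ≃g Γ, ¬ ∀ i, f (.inl i) = .inl (-i)) :
    ConnRealizes (q + Fintype.card W) (Multiplicative (ZMod q)) := by
  let e (t : ZMod q) : Equiv.Perm (ZMod q ⊕ W) :=
    { toFun := Sum.map (t + ·) (act t)
      invFun := Sum.map (-t + ·) (act (-t))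
      left_inv := by rintro (x | x) <;> simp [← act_add, act_zero]
      right_inv := by rintro (x | x) <;> simp [← act_add, act_zero] }
  let φ : Multiplicative (ZMod q) →* (Γ ≃g Γ) :=
    { toFun t := ⟨e t.toAdd, fun {a b} ↦ ⟨fun h ↦ by
        have := hact (-t.toAdd) _ _ h
        rwa [show ∀ x, Sum.map (-t.toAdd + ·) (act (-t.toAdd)) (e t.toAdd x) = x from
          (e t.toAdd).left_inv, show ∀ x, Sum.map (-t.toAdd + ·) (act (-t.toAdd)) (e t.toAdd x) = x
          from (e t.toAdd).left_inv] at this, hact _ _ _⟩⟩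
      map_one' := by ext (x | x) <;> simp [e, act_zero]
      map_mul' s t := by ext (x | x) <;> simp [e, act_add, RelIso.mul_apply, add_assoc] }
  have hcycle' (f : Γ ≃g Γ) (i) : ∃ j, f (.inl i) = .inl j := by
    rcases h : f (.inl i) with j | w
    · exact ⟨j, rfl⟩
    · exact (hcycle f i w h).elim
  have hfix (f : Γ ≃g Γ) (hf : ∀ i, f (.inl i) = .inl i) : f = 1 := by
    ext (i | w)
    · exact hf i
    · rcases h : f (.inr w) with j | w'
      · rw [← hf j] at h
        simpa using f.injective h
      · refine congrArg Sum.inr (htrace _ _ fun i ↦ ?_)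
        rw [← h, ← f.map_adj_iff (v := .inl i) (w := .inr w), hf]
  obtain ⟨ψ⟩ := nonempty_aut_mulEquiv_zmod (Γ := Γ) Sum.inl Sum.inl_injective hadj φ
    (fun t i ↦ rfl) hcycle' hfix hrefl
  have hreach (n : ℕ) : Γ.Reachable (.inl 0) (.inl (n : ZMod q)) := by
    induction n with
    | zero => simp
    | succ n ih =>
      by_cases h : (n : ZMod q) = (n + 1 : ℕ)
      · rwa [← h]
      · exact ih.trans ((hadj _ _).2 ⟨h, by simp⟩).reachable
  have hreach' (v) : Γ.Reachable (.inl 0) v := by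
    rcases v with i | w
    · simpa using hreach i.val
    · obtain ⟨i, hi⟩ := hne w
      exact .trans (by simpa using hreach i.val) hi.reachable
  have hconn : Γ.Connected :=
    { preconnected v w := (hreach' v).symm.trans (hreach' w), nonempty := ⟨.inl 0⟩ }
  simpa [ZMod.card] using ConnRealizes.of_graph Γ hconn ψ

/-- The cyclic `q`-cycle together with a clique indexed by `ZMod m`, where the vertex `b` of the
clique is joined to the residue classes `b`, `b + 1` and `b + 3` modulo `m` of the cycle. -/
def cliqueGraph {q m : ℕ} (h : m ∣ q) : SimpleGraph (ZMod q ⊕ ZMod m) where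
  Adj
    | .inl i, .inl j => i ≠ j ∧ (j = i + 1 ∨ i = j + 1)
    | .inl i, .inr b | .inr b, .inl i =>
      ZMod.castHom h (ZMod m) i = b ∨ ZMod.castHom h (ZMod m) i = b + 1 ∨
        ZMod.castHom h (ZMod m) i = b + 3
    | .inr b, .inr b' => b ≠ b'
  symm.symm := by rintro (i | b) (j | b') <;> grind
  loopless.irrefl := by rintro (i | b) <;> simp

lemma natCast_ne_zero_of_lt {m k : ℕ} (hk : 0 < k) (hkm : k < m) : (k : ZMod m) ≠ 0 := by
  rw [Ne, ZMod.natCast_eq_zero_iff]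
  exact Nat.not_dvd_of_pos_of_lt hk hkm

lemma connRealizes_cliqueGraph {q m : ℕ} (h : m ∣ q) (hq : 0 < q) (hm : 6 ≤ m) :
    ConnRealizes (q + m) (Multiplicative (ZMod q)) := by
  have : NeZero q := ⟨hq.ne'⟩
  have : NeZero m := ⟨by omega⟩
  have h1 : (1 : ZMod m) ≠ 0 := by simpa using natCast_ne_zero_of_lt (m := m) one_pos (by omega)
  have h2 : (2 : ZMod m) ≠ 0 := by simpa using natCast_ne_zero_of_lt (m := m) two_pos (by omega)
  have h3 : (3 : ZMod m) ≠ 0 := by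
    simpa using natCast_ne_zero_of_lt (m := m) (k := 3) (by omega) (by omega)
  have h4 : (4 : ZMod m) ≠ 0 := by
    simpa using natCast_ne_zero_of_lt (m := m) (k := 4) (by omega) (by omega)
  have h5 : (5 : ZMod m) ≠ 0 := by
    simpa using natCast_ne_zero_of_lt (m := m) (k := 5) (by omega) (by omega)
  let c := ZMod.castHom h (ZMod m)
  have hc : Function.Surjective c := ZMod.castHom_surjective h
  have hlr (i b) : (cliqueGraph h).Adj (.inl i) (.inr b) ↔ c i = b ∨ c i = b + 1 ∨ c i = b + 3 :=
    .rfl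
  have hll (i j) : (cliqueGraph h).Adj (.inl i) (.inl j) ↔ i ≠ j ∧ (j = i + 1 ∨ i = j + 1) := .rfl
  have hrr (b b') : (cliqueGraph h).Adj (.inr b) (.inr b') ↔ b ≠ b' := .rfl
  have htrace (w w') (hw : ∀ i, (cliqueGraph h).Adj (.inl i) (.inr w) ↔
      (cliqueGraph h).Adj (.inl i) (.inr w')) : w = w' := by
    simp only [hlr] at hw
    replace hw := fun b ↦ (hc b).elim fun i hi ↦ hi ▸ hw i
    have e1 := hw w
    have e2 := hw (w + 1)
    have e3 := hw (w + 3)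
    grind
  have key := ConnRealizes.of_cycle (cliqueGraph h) (fun t w ↦ c t + w) (by simp)
    (by simp [add_assoc]) hll ?_ ?_ ?_ htrace ?_
  · simpa [ZMod.card] using key
  · rintro t (i | b) (j | b') hA
    · simp only [Sum.map_inl, hll] at hA ⊢
      grind
    · simp only [Sum.map_inl, Sum.map_inr, hlr, map_add] at hA ⊢
      grind
    · rw [SimpleGraph.adj_comm] at hA ⊢
      simp only [Sum.map_inl, Sum.map_inr, hlr, map_add] at hA ⊢
      grind
    · simp only [Sum.map_inr, hrr] at hA ⊢
      grind
  · intro f i b hf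
    obtain ⟨j, hj⟩ := hc b
    have hsub : ∀ v, v = .inl j ∨ (∃ b', b' ≠ b ∧ v = .inr b') →
        f.symm v ∈ ({.inl (i + 1), .inl (i - 1), .inr (c i), .inr (c i - 1), .inr (c i - 3)} :
          Finset (ZMod q ⊕ ZMod m)) := by
      intro v hv
      have hadj : (cliqueGraph h).Adj (.inr b) v := by
        rcases hv with rfl | ⟨b', hb', rfl⟩
        · rw [SimpleGraph.adj_comm, hlr]; exact .inl hj
        · exact hb'.symm
      rw [← hf, ← f.apply_symm_apply v, f.map_adj_iff] at hadj
      generalize f.symm v = u at hadj ⊢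
      rcases u with x | x
      · rw [hll] at hadj; simp only [Finset.mem_insert, Finset.mem_singleton]; grind
      · rw [hlr] at hadj; simp only [Finset.mem_insert, Finset.mem_singleton]; grind
    let S : Finset (ZMod q ⊕ ZMod m) :=
      insert (.inl j) ((Finset.univ.erase b).map ⟨.inr, Sum.inr_injective⟩)
    have hS : S.card = m := by
      rw [Finset.card_insert_of_notMem (by simp), Finset.card_map, Finset.card_erase_of_mem (by simp),
        Finset.card_univ, ZMod.card]
      omega
    have := Finset.card_le_card_of_injOn (s := S) f.symm (fun v hv ↦ hsub v (by
      replace hv : v ∈ S := hv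
      simp only [S, Finset.mem_insert, Finset.mem_map, Finset.mem_erase, Finset.mem_univ,
        and_true] at hv
      exact hv.imp_right fun ⟨b', hb', e⟩ ↦ ⟨b', hb', e.symm⟩)) f.symm.injective.injOn
    have := this.trans Finset.card_le_five
    omega
  · exact fun w ↦ (hc w).imp fun i hi ↦ (hlr _ _).2 (.inl hi)
  · intro f hf
    rcases hw : f (.inr 0) with j | w
    · rw [← neg_neg j, ← hf] at hw
      simpa using f.injective hw
    · have hA (i) : (cliqueGraph h).Adj (.inl (-i)) (.inr w) ↔
          (cliqueGraph h).Adj (.inl i) (.inr 0) := by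
        rw [← hw, ← hf, f.map_adj_iff]
      simp only [hlr, map_neg] at hA
      replace hA := fun b ↦ (hc b).elim fun i hi ↦ hi ▸ hA i
      have e0 := hA 0
      have e1 := hA 1
      have e3 := hA 3
      grind

/-- The cyclic `q`-cycle together with vertices indexed by `ZMod m` and `ZMod l`, where
`b : ZMod m` is joined to the residue classes `b` and `b + 1` modulo `m` of the cycle,
`d : ZMod l` is joined to its residue class of the cycle, and `b` is joined to its residue modulo
`l`. If `s` is true, then `ZMod m` forms a clique. -/
def towerGraph {q m l : ℕ} (s : Bool) (h : m ∣ q) (h' : l ∣ m) :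
    SimpleGraph (ZMod q ⊕ (ZMod m ⊕ ZMod l)) where
  Adj
    | .inl i, .inl j => i ≠ j ∧ (j = i + 1 ∨ i = j + 1)
    | .inl i, .inr (.inl b) | .inr (.inl b), .inl i =>
      ZMod.castHom h (ZMod m) i = b ∨ ZMod.castHom h (ZMod m) i = b + 1
    | .inl i, .inr (.inr d) | .inr (.inr d), .inl i =>
      ZMod.castHom h' (ZMod l) (ZMod.castHom h (ZMod m) i) = d
    | .inr (.inl b), .inr (.inr d) | .inr (.inr d), .inr (.inl b) =>
      ZMod.castHom h' (ZMod l) b = d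
    | .inr (.inl b), .inr (.inl b') => s = true ∧ b ≠ b'
    | .inr (.inr _), .inr (.inr _) => False
  symm.symm := by rintro (i | b | d) (j | b' | d') <;> grind
  loopless.irrefl := by rintro (i | b | d) <;> simp

instance {q m l : ℕ} (s : Bool) (h : m ∣ q) (h' : l ∣ m) :
    DecidableRel (towerGraph s h h').Adj
  | .inl i, .inl j => inferInstanceAs (Decidable (i ≠ j ∧ (j = i + 1 ∨ i = j + 1)))
  | .inl i, .inr (.inl b) | .inr (.inl b), .inl i => inferInstanceAs
      (Decidable (ZMod.castHom h (ZMod m) i = b ∨ ZMod.castHom h (ZMod m) i = b + 1))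
  | .inl i, .inr (.inr d) | .inr (.inr d), .inl i => inferInstanceAs
      (Decidable (ZMod.castHom h' (ZMod l) (ZMod.castHom h (ZMod m) i) = d))
  | .inr (.inl b), .inr (.inr d) | .inr (.inr d), .inr (.inl b) => inferInstanceAs
      (Decidable (ZMod.castHom h' (ZMod l) b = d))
  | .inr (.inl b), .inr (.inl b') => inferInstanceAs (Decidable (s = true ∧ b ≠ b'))
  | .inr (.inr _), .inr (.inr _) => inferInstanceAs (Decidable False)

lemma connRealizes_towerGraph {q m l : ℕ} [NeZero q] [NeZero m] [NeZero l]
    (s : Bool) (h : m ∣ q) (h' : l ∣ m) (hm : 3 ≤ m) (hl : 2 ≤ l)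
    (hdeg : ∀ i w, (towerGraph s h h').degree (.inl i) ≠ (towerGraph s h h').degree (.inr w)) :
    ConnRealizes (q + (m + l)) (Multiplicative (ZMod q)) := by
  have h1 : (1 : ZMod m) ≠ 0 := by simpa using natCast_ne_zero_of_lt (m := m) one_pos (by omega)
  have h2 : (2 : ZMod m) ≠ 0 := by simpa using natCast_ne_zero_of_lt (m := m) two_pos (by omega)
  have h1' : (1 : ZMod l) ≠ 0 := by simpa using natCast_ne_zero_of_lt (m := l) one_pos (by omega)
  let c := ZMod.castHom h (ZMod m)
  let c' := ZMod.castHom h' (ZMod l)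
  have hc : Function.Surjective c := ZMod.castHom_surjective h
  have hc' : Function.Surjective c' := ZMod.castHom_surjective h'
  set Γ := towerGraph s h h'
  have hll (i j) : Γ.Adj (.inl i) (.inl j) ↔ i ≠ j ∧ (j = i + 1 ∨ i = j + 1) := .rfl
  have hlb (i b) : Γ.Adj (.inl i) (.inr (.inl b)) ↔ c i = b ∨ c i = b + 1 := .rfl
  have hld (i d) : Γ.Adj (.inl i) (.inr (.inr d)) ↔ c' (c i) = d := .rfl
  have hbd (b d) : Γ.Adj (.inr (.inl b)) (.inr (.inr d)) ↔ c' b = d := .rfl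
  have hbb (b b') : Γ.Adj (.inr (.inl b)) (.inr (.inl b')) ↔ s = true ∧ b ≠ b' := .rfl
  have hdd (d d') : ¬ Γ.Adj (.inr (.inr d)) (.inr (.inr d')) := id
  have hbd_trace (b d) : ¬ ∀ i, Γ.Adj (.inl i) (.inr (.inl b)) ↔ Γ.Adj (.inl i) (.inr (.inr d)) := by
    intro hw
    obtain ⟨i, rfl⟩ := hc b
    have e1 := hw i
    have e2 := hw (i + 1)
    simp only [hlb, hld, map_add, map_one, true_or, or_true, true_iff] at e1 e2
    exact h1' (left_eq_add.1 (e1.trans e2.symm))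
  have htrace (w w') (hw : ∀ i, Γ.Adj (.inl i) (.inr w) ↔ Γ.Adj (.inl i) (.inr w')) : w = w' := by
    rcases w with b | d <;> rcases w' with b' | d'
    · simp only [hlb] at hw
      replace hw := fun b ↦ (hc b).elim fun i hi ↦ hi ▸ hw i
      have e1 := hw b
      have e2 := hw (b + 1)
      grind
    · exact (hbd_trace b d' hw).elim
    · exact (hbd_trace b' d fun i ↦ (hw i).symm).elim
    · obtain ⟨b, rfl⟩ := hc' d
      obtain ⟨i, rfl⟩ := hc b
      simpa [hld] using hw i
  have key := ConnRealizes.of_cycle Γ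
    (fun t w ↦ Sum.map (c t + ·) (c' (c t) + ·) w) (by rintro (w | w) <;> simp)
    (by rintro x y (w | w) <;> simp [add_assoc]) hll ?_ ?_ ?_ htrace ?_
  · simpa [ZMod.card] using key
  · rintro t (i | b | d) (j | b' | d') hA <;>
    first
    | simp only [Sum.map_inl, Sum.map_inr, hll, hlb, hld, hbd, hbb, map_add] at hA ⊢
      grind
    | exact (hdd _ _ hA).elim
    | rw [SimpleGraph.adj_comm] at hA ⊢
      simp only [Sum.map_inl, Sum.map_inr, hlb, hld, hbd, map_add] at hA ⊢
      grind
  · intro f i w hf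
    exact hdeg i w (by rw [← hf, f.degree_eq])
  · rintro (b | d)
    · exact (hc b).imp fun i hi ↦ (hlb _ _).2 (.inl hi)
    · exact ((hc'.comp hc) d).imp fun i hi ↦ (hld _ _).2 hi
  · intro f hf
    have hA (w w') (hw : f (.inr w) = .inr w') (i) :
        Γ.Adj (.inl (-i)) (.inr w') ↔ Γ.Adj (.inl i) (.inr w) := by
      rw [← hw, ← hf, f.map_adj_iff]
    have hout (w) : ∃ w', f (.inr w) = .inr w' := by
      rcases hw : f (.inr w) with j | w'
      · rw [← neg_neg j, ← hf] at hw
        simpa using f.injective hw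
      · exact ⟨w', rfl⟩
    obtain ⟨x, hx⟩ := hout (.inl 0)
    obtain ⟨y, hy⟩ := hout (.inr 0)
    have hx' : x = .inl (-1) := htrace _ _ fun i ↦ by
      have := hA _ _ hx (-i)
      rw [neg_neg] at this
      rw [this]
      simp only [hlb, map_neg]
      grind
    have hy' : y = .inr 0 := htrace _ _ fun i ↦ by
      have := hA _ _ hy (-i)
      rw [neg_neg] at this
      rw [this]
      simp only [hld, map_neg]
      grind
    have := f.map_adj_iff (v := .inr (.inl 0)) (w := .inr (.inr 0))
    rw [hx, hy, hx', hy', hbd, hbd] at this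
    simp at this
    exact h1' this

lemma connRealizes_three : ConnRealizes 9 (Multiplicative (ZMod 3)) :=
  connRealizes_towerGraph (q := 3) (m := 3) (l := 3) false (by decide) (by decide) (by decide)
    (by decide) (by decide +kernel)

lemma connRealizes_four : ConnRealizes 10 (Multiplicative (ZMod 4)) :=
  connRealizes_towerGraph (q := 4) (m := 4) (l := 2) false (by decide) (by decide) (by decide)
    (by decide) (by decide +kernel)

lemma connRealizes_five : ConnRealizes 15 (Multiplicative (ZMod 5)) :=
  connRealizes_towerGraph (q := 5) (m := 5) (l := 5) false (by decide) (by decide) (by decide)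
    (by decide) (by decide +kernel)

lemma connRealizes_eight : ConnRealizes 14 (Multiplicative (ZMod 8)) :=
  connRealizes_towerGraph (q := 8) (m := 4) (l := 2) true (by decide) (by decide) (by decide)
    (by decide) (by decide +kernel)

lemma connRealizes_nine : ConnRealizes 15 (Multiplicative (ZMod 9)) :=
  connRealizes_towerGraph (q := 9) (m := 3) (l := 3) false (by decide) (by decide) (by decide)
    (by decide) (by decide +kernel)

lemma connRealizes_twentyFive : ConnRealizes 35 (Multiplicative (ZMod 25)) :=
  connRealizes_towerGraph (q := 25) (m := 5) (l := 5) false (by decide) (by decide) (by decide)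
    (by decide) (by decide +kernel)

lemma nonempty_aut_top_mulEquiv :
    Nonempty (((⊤ : SimpleGraph (Fin 2)) ≃g (⊤ : SimpleGraph (Fin 2))) ≃*
      Multiplicative (ZMod 2)) := by
  let Γ : SimpleGraph (Fin 2) := ⊤
  have hc : Nat.card (Γ ≃g Γ) = 2 := by
    have e : (Γ ≃g Γ) ≃ Equiv.Perm (Fin 2) :=
      ⟨fun f ↦ f.toEquiv, fun f ↦ ⟨f, by simp [Γ]⟩, fun _ ↦ rfl, fun _ ↦ rfl⟩
    rw [Nat.card_congr e, Nat.card_eq_fintype_card]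
    decide
  have : IsCyclic (Γ ≃g Γ) := isCyclic_of_prime_card (p := 2) hc
  exact ⟨mulEquivOfCyclicCardEq (by simpa using hc)⟩

lemma connRealizes_two : ConnRealizes 2 (Multiplicative (ZMod 2)) :=
  ⟨⊤, SimpleGraph.connected_top, nonempty_aut_top_mulEquiv⟩

lemma realizes_two_two : Realizes 4 (Multiplicative (ZMod 2) × Multiplicative (ZMod 2)) := by
  obtain ⟨e⟩ := nonempty_aut_top_mulEquiv
  let Γ : SimpleGraph (Fin 2) := ⊤
  have h (f : (Γ ⊕g Γᶜ) ≃g (Γ ⊕g Γᶜ)) (v : Fin 2) : ∃ v', f (.inl v) = .inl v' := by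
    have hv : (Γ ⊕g Γᶜ).Adj (.inl v) (.inl (v + 1)) := by
      revert v
      simp [Γ]
    have hfv := f.map_adj_iff.2 hv
    rcases h : f (.inl v) with v' | w
    · exact ⟨v', rfl⟩
    · rw [h] at hfv
      rcases h' : f (.inl (v + 1)) with x | x <;> simp [h', Γ] at hfv
  obtain ⟨φ⟩ := nonempty_aut_sum_mulEquiv h
  simpa using Realizes.of_graph _ (φ.trans (e.prodCongr ((autCompl Γ).symm.trans e)))

lemma card_multiplicative_prod_zmod (q r : ℕ) :
    Nat.card (Multiplicative (ZMod q × ZMod r)) = q * r := by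
  simp [Nat.card_congr Multiplicative.toAdd, Nat.card_prod]

lemma not_isPrimePow_six : ¬ IsPrimePow 6 := by
  rintro ⟨p, k, hp, -, h⟩
  have h2 := (Nat.prime_dvd_prime_iff_eq Nat.prime_two hp.nat_prime).1
    (Nat.prime_two.dvd_of_dvd_pow (h ▸ by norm_num : 2 ∣ p ^ k))
  have h3 := (Nat.prime_dvd_prime_iff_eq Nat.prime_three hp.nat_prime).1
    (Nat.prime_three.dvd_of_dvd_pow (h ▸ by norm_num : 3 ∣ p ^ k))
  omega

lemma ConnRealizes.mono {m n : ℕ} {G : Type*} [Group G] (h : ConnRealizes m G) (hm : 2 ≤ m)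
    (hmn : m ≤ n) : ConnRealizes n G := by
  induction n, hmn using Nat.le_induction with
  | base => exact h
  | succ n hn ih => exact ih.succ (hm.trans hn)

lemma connRealizes_two_mul {q : ℕ} (hq : 6 ≤ q) :
    ConnRealizes (2 * q) (Multiplicative (ZMod q)) :=
  two_mul q ▸ connRealizes_cliqueGraph dvd_rfl (by omega) hq

lemma exists_connRealizes {q : ℕ} (hq : 2 ≤ q) :
    ∃ n, 2 ≤ n ∧ ConnRealizes n (Multiplicative (ZMod q)) := by
  obtain rfl | rfl | rfl | rfl | h : q = 2 ∨ q = 3 ∨ q = 4 ∨ q = 5 ∨ 6 ≤ q := by omega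
  · exact ⟨_, by simp, connRealizes_two⟩
  · exact ⟨_, by simp, connRealizes_three⟩
  · exact ⟨_, by simp, connRealizes_four⟩
  · exact ⟨_, by simp, connRealizes_five⟩
  · exact ⟨_, by omega, connRealizes_two_mul h⟩

lemma ConnRealizes.prod_zmod {m n q r : ℕ} (h : ConnRealizes m (Multiplicative (ZMod q)))
    (h' : ConnRealizes n (Multiplicative (ZMod r))) (hmn : m ≠ n) :
    Realizes (m + n) (Multiplicative (ZMod q × ZMod r)) :=
  (h.prod h' hmn).congr (MulEquiv.prodMultiplicative _ _).symm

lemma exists_realizes_prod_zmod {q r : ℕ} (hq : 2 ≤ q) (hr : 2 ≤ r) :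
    ∃ n, Realizes n (Multiplicative (ZMod q × ZMod r)) := by
  obtain ⟨m, hm, h⟩ := exists_connRealizes hq
  obtain ⟨n, hn, h'⟩ := exists_connRealizes hr
  exact ⟨_, (h.mono hm (by omega : m ≤ max m n)).prod_zmod
    (h'.mono hn (by omega : n ≤ max m n + 1)) (by omega)⟩

/-- If `C_r` is realized by a connected graph on at most `2 (r - 1)` vertices, then `C₂ × C_r` is
realized on at most `2 r` vertices. -/
lemma graphAlpha_two_prod_le {r n : ℕ} (h : ConnRealizes n (Multiplicative (ZMod r)))
    (hn : 2 < n) (hr : 2 + n ≤ 2 * r) : graphAlpha (Multiplicative (ZMod 2 × ZMod r)) ≤ 2 * r :=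
  (connRealizes_two.prod_zmod h (by omega)).graphAlpha_le.trans hr

lemma isCyclic_prod_zmod {q r : ℕ} (h : q.Coprime r) :
    IsCyclic (Multiplicative (ZMod q × ZMod r)) :=
  isCyclic_of_surjective (ZMod.chineseRemainder h).toAddEquiv.toMultiplicative.toMonoidHom
    (MulEquiv.surjective _)

lemma graphAlpha_le_of_not_exceptional {q r : ℕ} (hq : IsPrimePow q) (hr : IsPrimePow r)
    (hqr : q ≤ r) (h₁ : ¬ ExcCyclic (Multiplicative (ZMod q × ZMod r)))
    (h₂ : ¬ ExcEight (Multiplicative (ZMod q × ZMod r))) :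
    graphAlpha (Multiplicative (ZMod q × ZMod r)) ≤ q * r := by
  have hq2 := hq.two_le
  have hcrt {n : ℕ} (h : q.Coprime r) (hn : q * r = n) :
      Nonempty (Multiplicative (ZMod q × ZMod r) ≃* Cyc n) := by
    subst hn
    exact ⟨(ZMod.chineseRemainder h).toAddEquiv.toMultiplicative.symm⟩
  simp only [ExcEight, not_or] at h₂
  obtain ⟨h12, h15, h20, h21, h24, h33, h44, h55⟩ := h₂
  obtain rfl | rfl | rfl | rfl | h : q = 2 ∨ q = 3 ∨ q = 4 ∨ q = 5 ∨ 6 ≤ q := by omega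
  · obtain ⟨p, k, hp, hk, rfl⟩ := hr
    have hp := hp.nat_prime
    rcases eq_or_ne p 2 with rfl | hp2
    · obtain rfl | rfl | rfl | hk : k = 1 ∨ k = 2 ∨ k = 3 ∨ 4 ≤ k := by omega
      · exact (realizes_two_two.congr (MulEquiv.prodMultiplicative _ _).symm).graphAlpha_le
      · exact absurd ⟨MulEquiv.refl _⟩ h24
      · exact graphAlpha_two_prod_le connRealizes_eight (by norm_num) (by norm_num)
      · obtain ⟨k, rfl⟩ : ∃ l, k = l + 4 := ⟨k - 4, by omega⟩
        have : 1 ≤ 2 ^ k := Nat.one_le_two_pow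
        refine graphAlpha_two_prod_le (connRealizes_cliqueGraph (m := 2 ^ (k + 3))
          (pow_dvd_pow 2 (by omega)) (by positivity) ?_) ?_ ?_ <;>
        · simp only [pow_add]
          omega
    · have hodd := hp.odd_of_ne_two hp2
      have h3 : 3 ≤ p := by have := hp.two_le; omega
      obtain rfl | hk : k = 1 ∨ 2 ≤ k := by omega
      · refine absurd ⟨isCyclic_prod_zmod ?_, ?_, Or.inr ⟨p, hp, ?_⟩⟩ h₁
        · simpa using hodd
        · rw [card_multiplicative_prod_zmod, pow_one]
          omega
        · rw [card_multiplicative_prod_zmod, pow_one]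
      · obtain ⟨k, rfl⟩ : ∃ l, k = l + 2 := ⟨k - 2, by omega⟩
        by_cases h6 : 6 ≤ p ^ (k + 1)
        · refine graphAlpha_two_prod_le (connRealizes_cliqueGraph (m := p ^ (k + 1))
            (pow_dvd_pow p (by omega)) (pow_pos hp.pos _) h6) (by omega) ?_
          have : p ^ (k + 2) = p ^ (k + 1) * p := pow_succ _ _
          nlinarith
        · obtain rfl : k = 0 := by
            by_contra hk
            have : p ^ 2 ≤ p ^ (k + 1) := Nat.pow_le_pow_right hp.pos (by omega)
            nlinarith
          simp only [zero_add, pow_one] at h6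
          obtain rfl | rfl | rfl : p = 3 ∨ p = 4 ∨ p = 5 := by omega
          · exact graphAlpha_two_prod_le connRealizes_nine (by norm_num) (by norm_num)
          · exact absurd hp (by norm_num)
          · exact graphAlpha_two_prod_le connRealizes_twentyFive (by norm_num) (by norm_num)
  · have h6 : r ≠ 6 := by rintro rfl; exact not_isPrimePow_six hr
    obtain rfl | rfl | rfl | rfl | rfl | h : r = 3 ∨ r = 4 ∨ r = 5 ∨ r = 7 ∨ r = 8 ∨ 9 ≤ r := by
      omega
    · exact absurd ⟨MulEquiv.refl _⟩ h33
    · exact absurd (hcrt (by norm_num) rfl) h12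
    · exact absurd (hcrt (by norm_num) rfl) h15
    · exact absurd (hcrt (by norm_num) rfl) h21
    · exact (connRealizes_three.prod_zmod connRealizes_eight (by norm_num)).graphAlpha_le.trans
        (by norm_num)
    · exact (connRealizes_three.prod_zmod (connRealizes_two_mul (by omega))
        (by omega)).graphAlpha_le.trans (by omega)
  · obtain rfl | rfl | h : r = 4 ∨ r = 5 ∨ 6 ≤ r := by omega
    · exact absurd ⟨MulEquiv.refl _⟩ h44
    · exact absurd (hcrt (by norm_num) rfl) h20
    · exact (connRealizes_four.prod_zmod (connRealizes_two_mul h)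
        (by omega)).graphAlpha_le.trans (by omega)
  · obtain rfl | h : r = 5 ∨ 6 ≤ r := by omega
    · exact absurd ⟨MulEquiv.refl _⟩ h55
    · exact (connRealizes_five.prod_zmod (connRealizes_two_mul h)
        (by omega)).graphAlpha_le.trans (by omega)
  · exact ((connRealizes_two_mul h).prod_zmod
      ((connRealizes_two_mul (h.trans hqr)).mono (by omega) (Nat.le_succ _))
        (by omega)).graphAlpha_le.trans (by nlinarith)

/-- The action of `G` on the vertices of `Γ` identifies `G` with the automorphism group of `Γ`. -/
structure IsAutAction (G : Type*) {V : Type*} [Group G] [MulAction G V] (Γ : SimpleGraph V) :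
    Prop where
  eq_one : ∀ g : G, (∀ x : V, g • x = x) → g = 1
  adj_smul : ∀ (g : G) (x y : V), Γ.Adj (g • x) (g • y) ↔ Γ.Adj x y
  exists_smul : ∀ f : Γ ≃g Γ, ∃ g : G, ∀ x, f x = g • x

lemma card_lt_graphAlpha {G : Type*} [Group G] (hG : ∃ n, Realizes n G)
    (h : ∀ (n : ℕ) (_ : MulAction G (Fin n)) (Γ : SimpleGraph (Fin n)),
      IsAutAction G Γ → Nat.card G < n) : Nat.card G < graphAlpha G := by
  obtain ⟨Γ, ⟨e⟩⟩ : graphAlpha G ∈ {n | Realizes n G} := Nat.sInf_mem hG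
  let _ : MulAction G (Fin (graphAlpha G)) :=
    { smul g x := e.symm g x
      one_smul x := by change e.symm 1 x = x; simp
      mul_smul g h x := by change e.symm (g * h) x = e.symm g (e.symm h x); simp [RelIso.mul_apply] }
  refine h _ inferInstance Γ ⟨fun g hg ↦ ?_, fun g x y ↦ (e.symm g).map_adj_iff, fun f ↦ ⟨e f, ?_⟩⟩
  · have : e.symm g = 1 := RelIso.ext hg
    simpa using this
  · intro x
    change _ = e.symm (e f) x
    simp

namespace IsAutAction

section Group

variable {G V : Type*} [Group G] [MulAction G V] {Γ : SimpleGraph V}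

lemma exists_smul_ne (hΓ : IsAutAction G Γ) {g : G} (hg : g ≠ 1) : ∃ x : V, g • x ≠ x := by
  by_contra! h
  exact hg (hΓ.eq_one g h)

lemma adj_smul_right_iff (hΓ : IsAutAction G Γ) {g : G} {y : V} (h : g • y = y) (x : V) :
    Γ.Adj y (g • x) ↔ Γ.Adj y x := by
  conv_lhs => rw [← h]
  exact hΓ.adj_smul g y x

lemma exists_smul_of_involutive (hΓ : IsAutAction G Γ) (π : V → V) (h : ∀ x, π (π x) = x)
    (hadj : ∀ x y, Γ.Adj x y → Γ.Adj (π x) (π y)) : ∃ k : G, ∀ x, π x = k • x :=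
  hΓ.exists_smul ⟨⟨π, π, h, h⟩, fun {x y} ↦
    ⟨fun hxy ↦ by simpa [h] using hadj _ _ hxy, hadj x y⟩⟩

end Group

variable {G V : Type*} [CommGroup G] [MulAction G V] {Γ : SimpleGraph V}

open Classical in
/-- The involution `g • a ↦ g⁻¹ • a`, `g • b ↦ (g⁻¹ * c) • b` on two orbits of `H`, if it is an
automorphism, has to commute with `H`. -/
lemma smul_smul_eq_of_two_orbits (hΓ : IsAutAction G Γ) (H : Subgroup G) {a b : V} {c : G}
    (hc : c ∈ H)
    (h₁ : ∀ y, (∀ g ∈ H, y ≠ g • a) → (∀ g ∈ H, y ≠ g • b) →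
      ∀ g ∈ H, Γ.Adj y (g • a) → Γ.Adj y (g⁻¹ • a))
    (h₂ : ∀ y, (∀ g ∈ H, y ≠ g • a) → (∀ g ∈ H, y ≠ g • b) →
      ∀ g ∈ H, Γ.Adj y (g • b) → Γ.Adj y ((g⁻¹ * c) • b))
    (h₃ : (∀ g ∈ H, b ≠ g • a) → ∀ g ∈ H, Γ.Adj a (g • b) → Γ.Adj a ((g⁻¹ * c) • b))
    {g : G} (hg : g ∈ H) : g • g • a = a := by
  let π (x : V) : V :=
    if h : ∃ g ∈ H, x = g • a then h.choose⁻¹ • a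
    else if h : ∃ g ∈ H, x = g • b then (h.choose⁻¹ * c) • b else x
  have inv_congr {x : V} {g g' : G} (h : g • x = g' • x) : g⁻¹ • x = g'⁻¹ • x := by
    rw [inv_smul_eq_iff, smul_comm, h, inv_smul_smul]
  have πa {g : G} (hg : g ∈ H) : π (g • a) = g⁻¹ • a := by
    have h : ∃ g' ∈ H, g • a = g' • a := ⟨g, hg, rfl⟩
    simp only [π, dif_pos h]
    exact inv_congr h.choose_spec.2.symm
  have πo {x : V} (ha : ∀ g ∈ H, x ≠ g • a) (hb : ∀ g ∈ H, x ≠ g • b) : π x = x := by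
    have ha' : ¬ ∃ g ∈ H, x = g • a := by push Not; exact ha
    have hb' : ¬ ∃ g ∈ H, x = g • b := by push Not; exact hb
    simp only [π, dif_neg ha', dif_neg hb']
  have not_mem (hb : ∀ g ∈ H, b ≠ g • a) {g : G} (hg : g ∈ H) : ∀ k ∈ H, g • b ≠ k • a :=
    fun k hk h ↦ hb (g⁻¹ * k) (H.mul_mem (H.inv_mem hg) hk) (by rw [mul_smul, ← h, inv_smul_smul])
  have πb (hb : ∀ g ∈ H, b ≠ g • a) {g : G} (hg : g ∈ H) : π (g • b) = (g⁻¹ * c) • b := by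
    have h : ∃ g' ∈ H, g • b = g' • b := ⟨g, hg, rfl⟩
    have ha' : ¬ ∃ k ∈ H, g • b = k • a := by push Not; exact not_mem hb hg
    simp only [π, dif_neg ha', dif_pos h]
    rw [mul_comm, mul_smul, mul_comm, mul_smul]
    exact congrArg _ (inv_congr h.choose_spec.2.symm)
  have orbit_cases (x : V) : (∃ g ∈ H, x = g • a) ∨
      ((∀ g ∈ H, b ≠ g • a) ∧ ∃ g ∈ H, x = g • b) ∨
      ((∀ g ∈ H, x ≠ g • a) ∧ ∀ g ∈ H, x ≠ g • b) := by
    by_cases hx : ∃ g ∈ H, x = g • a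
    · exact .inl hx
    by_cases hx' : ∃ g ∈ H, x = g • b
    · refine .inr (.inl ⟨?_, hx'⟩)
      rintro k hk rfl
      obtain ⟨g, hg, rfl⟩ := hx'
      exact hx ⟨g * k, H.mul_mem hg hk, (mul_smul _ _ _).symm⟩
    · push Not at hx hx'
      exact .inr (.inr ⟨hx, hx'⟩)
  have hinv (x : V) : π (π x) = x := by
    obtain ⟨g, hg, rfl⟩ | ⟨hb, g, hg, rfl⟩ | ⟨ha, hb⟩ := orbit_cases x
    · rw [πa hg, πa (H.inv_mem hg), inv_inv]
    · rw [πb hb hg, πb hb (H.mul_mem (H.inv_mem hg) hc)]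
      simp
    · rw [πo ha hb, πo ha hb]
  have hadj (x y : V) (hxy : Γ.Adj x y) : Γ.Adj (π x) (π y) := by
    have translate (k : G) {x y x' y' : V} (h : Γ.Adj x y) (hx : k • x = x') (hy : k • y = y') :
        Γ.Adj x' y' := by
      rw [← hx, ← hy]
      exact (hΓ.adj_smul k x y).2 h
    have hab (hb : ∀ g ∈ H, b ≠ g • a) {g g' : G} (hg : g ∈ H) (hg' : g' ∈ H)
        (h : Γ.Adj (g • a) (g' • b)) : Γ.Adj (π (g • a)) (π (g' • b)) := by
      rw [πa hg, πb hb hg']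
      have h' := h₃ hb (g⁻¹ * g') (H.mul_mem (H.inv_mem hg) hg')
        (translate g⁻¹ h (by simp) (by simp [mul_smul]))
      refine translate g⁻¹ h' rfl ?_
      rw [smul_smul, mul_inv, inv_inv, mul_assoc, inv_mul_cancel_left]
    obtain ⟨g, hg, rfl⟩ | ⟨hb, g, hg, rfl⟩ | ⟨ha, hb⟩ := orbit_cases x <;>
    obtain ⟨g', hg', rfl⟩ | ⟨hb', g', hg', rfl⟩ | ⟨ha', hb'⟩ := orbit_cases y
    · rw [πa hg, πa hg']
      refine (translate (g⁻¹ * g'⁻¹) hxy ?_ ?_).symm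
      · rw [smul_smul, mul_right_comm, inv_mul_cancel, one_mul]
      · rw [smul_smul, inv_mul_cancel_right]
    · exact hab hb' hg hg' hxy
    · rw [πa hg, πo ha' hb']
      exact (h₁ _ ha' hb' g hg hxy.symm).symm
    · exact (hab hb hg' hg hxy.symm).symm
    · rw [πb hb hg, πb hb hg']
      refine (translate (g⁻¹ * g'⁻¹ * c) hxy ?_ ?_).symm
      · rw [smul_smul, mul_right_comm, mul_right_comm g⁻¹, inv_mul_cancel, one_mul]
      · rw [smul_smul, mul_right_comm, inv_mul_cancel_right]
    · rw [πb hb hg, πo ha' hb']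
      exact (h₂ _ ha' hb' g hg hxy.symm).symm
    · rw [πa hg', πo ha hb]
      exact h₁ _ ha hb g' hg' hxy
    · rw [πb hb' hg', πo ha hb]
      exact h₂ _ ha hb g' hg' hxy
    · rwa [πo ha hb, πo ha' hb']
  obtain ⟨k, hk⟩ := hΓ.exists_smul_of_involutive π hinv hadj
  have h1 := hk (g • a)
  rw [πa hg, smul_comm, ← hk, ← one_smul G a, πa H.one_mem, inv_one, one_smul,
      inv_smul_eq_iff] at h1
  exact h1.symm

lemma smul_smul_eq_of_orbit (hΓ : IsAutAction G Γ) (H : Subgroup G) {a : V}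
    (h : ∀ y, (∀ g ∈ H, y ≠ g • a) → ∀ g ∈ H, Γ.Adj y (g • a) → Γ.Adj y (g⁻¹ • a))
    {g : G} (hg : g ∈ H) : g • g • a = a :=
  hΓ.smul_smul_eq_of_two_orbits H H.one_mem (fun y hy _ ↦ h y hy)
    (fun y hy _ ↦ by simpa using h y hy) (fun h ↦ absurd (one_smul G a).symm (h 1 H.one_mem)) hg

/-- A vertex with trivial stabilizer would lie in a regular orbit of `G`. -/
lemma exists_ne_one_smul_eq [Finite V] (hΓ : IsAutAction G Γ) (hcard : Nat.card V ≤ Nat.card G)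
    {g : G} (hg : g * g ≠ 1) (x : V) : ∃ h : G, h ≠ 1 ∧ h • x = x := by
  by_contra! H
  have hinj : Function.Injective (fun g : G ↦ g • x) := fun g g' h ↦ by
    by_contra hne
    refine H (g⁻¹ * g') (fun h' ↦ hne (inv_mul_eq_one.1 h')) ?_
    rw [mul_smul, inv_smul_eq_iff]
    exact h.symm
  have hsurj : Function.Surjective (fun g : G ↦ g • x) :=
    (hinj.bijective_of_nat_card_le hcard).2
  refine H _ hg ?_
  rw [mul_smul]
  refine hΓ.smul_smul_eq_of_orbit ⊤ (fun y hy ↦ ?_) (Subgroup.mem_top g)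
  obtain ⟨g, rfl⟩ := hsurj y
  exact absurd rfl (hy g (Subgroup.mem_top g))

open MulAction Subgroup in
lemma _root_.MulAction.ncard_orbit_zpowers [Finite V] (t : G) (x : V) :
    (orbit (zpowers t) x).ncard = Function.minimalPeriod (t • ·) x := by
  have := Fintype.ofFinite (orbit (zpowers t) x)
  rw [minimalPeriod_eq_card, ← Nat.card_coe_set_eq, Nat.card_eq_fintype_card]

open MulAction Subgroup in
/-- Orbit counting for an element `t` acting on `T` with all cycles of length `n`. -/
lemma two_mul_le_ncard [Finite V] (hΓ : IsAutAction G Γ) {t : G} {n : ℕ} {T : Set V} (hn : 3 ≤ n)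
    (hT : T.Nonempty) (hmem : ∀ x ∈ T, ∀ g : G, g • x ∈ T)
    (hper : ∀ x ∈ T, Function.minimalPeriod (t • ·) x = n)
    (hadj : ∀ y ∉ T, ∀ x ∈ T, Γ.Adj y ((t * t) • x) ↔ Γ.Adj y x) : 2 * n ≤ T.ncard := by
  obtain ⟨a, ha⟩ := hT
  have hsub (x) (hx : x ∈ T) : orbit (zpowers t) x ⊆ T := by
    rintro _ ⟨g, rfl⟩
    exact hmem x hx g
  by_cases hTa : T ⊆ orbit (zpowers t) a
  · have h2 : t • t • a = a := by
      refine hΓ.smul_smul_eq_of_orbit (zpowers t) (fun y hy ↦ ?_) (mem_zpowers t)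
      have hyT : y ∉ T := fun h ↦ by
        obtain ⟨g, rfl⟩ := hTa h
        exact hy g g.2 rfl
      have key (k : ℤ) (x : V) (hx : x ∈ T) : Γ.Adj y ((t * t) ^ k • x) ↔ Γ.Adj y x := by
        induction k with
        | zero => simp
        | succ k ih => rw [zpow_add_one, mul_comm, mul_smul, hadj y hyT _ (hmem _ hx _), ih]
        | pred k ih =>
          rw [← ih, ← hadj y hyT _ (hmem _ hx _), smul_smul, ← zpow_one_add]
          ring_nf
      rintro _ ⟨k, rfl⟩ h
      rw [← key (-k) _ (hmem a ha _), smul_smul, mul_zpow] at h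
      simpa using h
    have := pow_smul_eq_iff_minimalPeriod_dvd (a := t) (b := a) (n := 2)
    rw [hper a ha, pow_two, mul_smul] at this
    have := Nat.le_of_dvd (by norm_num) (this.1 h2)
    omega
  · obtain ⟨b, hb, hba⟩ := Set.not_subset.1 hTa
    have hdisj : Disjoint (orbit (zpowers t) a) (orbit (zpowers t) b) :=
      (orbit.eq_or_disjoint a b).resolve_left fun h ↦ hba (h ▸ mem_orbit_self b)
    calc 2 * n = (orbit (zpowers t) a ∪ orbit (zpowers t) b).ncard := by
          rw [Set.ncard_union_eq hdisj, ncard_orbit_zpowers, ncard_orbit_zpowers, hper a ha,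
            hper b hb, two_mul]
      _ ≤ T.ncard := Set.ncard_le_ncard (Set.union_subset (hsub a ha) (hsub b hb))

/-- Every subset of a cyclic group of order at most `5` is invariant under some reflection. -/
lemma _root_.ZMod.exists_reflection {n : ℕ} (hn : n = 3 ∨ n = 4 ∨ n = 5) (D : Set (ZMod n)) :
    ∃ c, ∀ i ∈ D, c - i ∈ D := by
  classical
  have h (n : ℕ) [NeZero n] (H : ∀ D : Finset (ZMod n), ∃ c, ∀ i ∈ D, c - i ∈ D)
      (D : Set (ZMod n)) : ∃ c, ∀ i ∈ D, c - i ∈ D := by simpa using H {i | i ∈ D}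
  obtain rfl | rfl | rfl := hn
  · exact h 3 (by decide) D
  · exact h 4 (by decide) D
  · exact h 5 (by decide +kernel) D

open MulAction Subgroup in
lemma three_mul_le_ncard [Finite V] (hΓ : IsAutAction G Γ) {t : G} {n : ℕ} {T : Set V}
    (hn : n = 3 ∨ n = 4 ∨ n = 5)
    (hT : T.Nonempty) (hmem : ∀ x ∈ T, ∀ g : G, g • x ∈ T)
    (hper : ∀ x ∈ T, Function.minimalPeriod (t • ·) x = n)
    (hadj : ∀ y ∉ T, ∀ x ∈ T, Γ.Adj y (t • x) ↔ Γ.Adj y x) : 3 * n ≤ T.ncard := by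
  have hadj' (y) (hy : y ∉ T) (k : ℤ) (x) (hx : x ∈ T) : Γ.Adj y (t ^ k • x) ↔ Γ.Adj y x := by
    induction k with
    | zero => simp
    | succ k ih => rw [zpow_add_one, mul_comm, mul_smul, hadj y hy _ (hmem _ hx _), ih]
    | pred k ih =>
      rw [← ih, ← hadj y hy _ (hmem _ hx _), smul_smul, ← zpow_one_add]
      ring_nf
  have hsub (x) (hx : x ∈ T) : orbit (zpowers t) x ⊆ T := by
    rintro _ ⟨g, rfl⟩
    exact hmem x hx g
  have hdisj {a b : V} (h : b ∉ orbit (zpowers t) a) :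
      Disjoint (orbit (zpowers t) a) (orbit (zpowers t) b) :=
    (orbit.eq_or_disjoint a b).resolve_left fun h' ↦ h (h' ▸ mem_orbit_self b)
  have h2 : 2 * n ≤ T.ncard := hΓ.two_mul_le_ncard (by omega) hT hmem hper
    fun y hy x hx ↦ by rw [← zpow_two]; exact hadj' y hy 2 x hx
  obtain ⟨a, ha⟩ := hT
  obtain ⟨b, hb, hba⟩ : ∃ b ∈ T, b ∉ orbit (zpowers t) a := by
    by_contra! h
    have := Set.ncard_le_ncard (s := T) h
    rw [ncard_orbit_zpowers, hper a ha] at this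
    omega
  by_cases hTab : T ⊆ orbit (zpowers t) a ∪ orbit (zpowers t) b
  · obtain ⟨c, hc⟩ := ZMod.exists_reflection hn {i | ∃ k : ℤ, k = i ∧ Γ.Adj a (t ^ k • b)}
    obtain ⟨c, rfl⟩ := ZMod.intCast_surjective c
    have h2 : t • t • a = a := by
      refine hΓ.smul_smul_eq_of_two_orbits (zpowers t) (b := b) (c := t ^ c) (zpow_mem_zpowers t c)
        ?_ ?_ ?_ (mem_zpowers t)
      · rintro y hya hyb _ ⟨k, rfl⟩ h
        have hy : y ∉ T := fun hy ↦ by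
          obtain ⟨g, rfl⟩ | ⟨g, rfl⟩ := hTab hy
          · exact hya g g.2 rfl
          · exact hyb g g.2 rfl
        rw [hadj' y hy k a ha] at h
        rwa [← zpow_neg, hadj' y hy _ a ha]
      · rintro y hya hyb _ ⟨k, rfl⟩ h
        have hy : y ∉ T := fun hy ↦ by
          obtain ⟨g, rfl⟩ | ⟨g, rfl⟩ := hTab hy
          · exact hya g g.2 rfl
          · exact hyb g g.2 rfl
        rw [hadj' y hy k b hb] at h
        rwa [← zpow_neg, ← zpow_add, hadj' y hy _ b hb]
      · rintro - _ ⟨k, rfl⟩ h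
        obtain ⟨l, hl, h'⟩ := hc k ⟨k, rfl, h⟩
        have hl' : ((l - (c - k) : ℤ) : ZMod n) = 0 := by
          push_cast
          rw [hl, sub_self]
        rw [ZMod.intCast_zmod_eq_zero_iff_dvd, ← hper b hb, ← zpow_smul_eq_iff_minimalPeriod_dvd]
          at hl'
        have : t ^ l • b = t ^ (c - k) • b := by
          conv_rhs => rw [← hl', smul_smul, ← zpow_add, add_sub_cancel]
        rwa [← zpow_neg, ← zpow_add, neg_add_eq_sub, ← this]
    have := pow_smul_eq_iff_minimalPeriod_dvd (a := t) (b := a) (n := 2)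
    rw [hper a ha, pow_two, mul_smul] at this
    have := Nat.le_of_dvd (by norm_num) (this.1 h2)
    omega
  · obtain ⟨d, hd, hdab⟩ := Set.not_subset.1 hTab
    rw [Set.mem_union, not_or] at hdab
    calc 3 * n = (orbit (zpowers t) a ∪ orbit (zpowers t) b ∪ orbit (zpowers t) d).ncard := by
          rw [Set.ncard_union_eq (Set.disjoint_union_left.2 ⟨hdisj hdab.1, hdisj hdab.2⟩),
            Set.ncard_union_eq (hdisj hba), ncard_orbit_zpowers, ncard_orbit_zpowers,
            ncard_orbit_zpowers, hper a ha, hper b hb, hper d hd]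
          ring
      _ ≤ T.ncard := Set.ncard_le_ncard
          (Set.union_subset (Set.union_subset (hsub a ha) (hsub b hb)) (hsub d hd))

open MulAction

lemma _root_.MulAction.isPeriodicPt_smul {t : G} {n : ℕ} {x : V} (h : t ^ n = 1) :
    Function.IsPeriodicPt (t • ·) n x := by
  simp [Function.IsPeriodicPt, Function.IsFixedPt, smul_iterate, h]

lemma smul_mem_compl_fixedBy {t : G} {x : V} (hx : x ∈ (fixedBy V t)ᶜ) (g : G) :
    g • x ∈ (fixedBy V t)ᶜ := by
  rwa [Set.mem_compl_iff, mem_fixedBy, smul_comm, smul_left_cancel_iff]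

lemma adj_smul_of_notMem_compl_fixedBy (hΓ : IsAutAction G Γ) {t : G} {y : V}
    (hy : y ∉ (fixedBy V t)ᶜ) (x : V) : Γ.Adj y (t • x) ↔ Γ.Adj y x :=
  hΓ.adj_smul_right_iff (not_not.1 hy) x

lemma compl_fixedBy_nonempty (hΓ : IsAutAction G Γ) {t : G} (ht : t ≠ 1) :
    ((fixedBy V t)ᶜ).Nonempty := hΓ.exists_smul_ne ht

lemma minimalPeriod_of_prime {t : G} {p : ℕ} (hp : p.Prime) (ht : t ^ p = 1) {x : V}
    (hx : x ∈ (fixedBy V t)ᶜ) : Function.minimalPeriod (t • ·) x = p :=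
  have := Fact.mk hp
  Function.minimalPeriod_eq_prime (isPeriodicPt_smul ht) hx

lemma minimalPeriod_of_four {t : G} (ht : t ^ 4 = 1) {x : V} (hx : x ∈ (fixedBy V (t * t))ᶜ) :
    Function.minimalPeriod (t • ·) x = 4 := by
  have := Fact.mk Nat.prime_two
  refine Function.minimalPeriod_eq_prime_pow (p := 2) (k := 1) (fun h ↦ hx ?_)
    (isPeriodicPt_smul ht)
  simpa [Function.IsPeriodicPt, Function.IsFixedPt, mul_smul] using h

lemma two_mul_prime_le_ncard [Finite V] (hΓ : IsAutAction G Γ) {t : G} {p : ℕ} (hp : p.Prime)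
    (hp2 : p ≠ 2) (ht : t ^ p = 1) (ht1 : t ≠ 1) : 2 * p ≤ (fixedBy V t)ᶜ.ncard := by
  refine hΓ.two_mul_le_ncard (t := t) (by have := hp.two_le; omega) (hΓ.compl_fixedBy_nonempty ht1)
    (fun x hx ↦ smul_mem_compl_fixedBy hx) (fun x ↦ minimalPeriod_of_prime hp ht)
    (fun y hy x _ ↦ ?_)
  rw [mul_smul, hΓ.adj_smul_of_notMem_compl_fixedBy hy, hΓ.adj_smul_of_notMem_compl_fixedBy hy]

lemma three_mul_prime_le_ncard [Finite V] (hΓ : IsAutAction G Γ) {t : G} {p : ℕ}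
    (hp : p = 3 ∨ p = 5) (ht : t ^ p = 1) (ht1 : t ≠ 1) : 3 * p ≤ (fixedBy V t)ᶜ.ncard := by
  have hp' : p.Prime := by rcases hp with rfl | rfl <;> norm_num
  exact hΓ.three_mul_le_ncard (t := t) (by omega) (hΓ.compl_fixedBy_nonempty ht1)
    (fun x hx ↦ smul_mem_compl_fixedBy hx) (fun x ↦ minimalPeriod_of_prime hp' ht)
    (fun y hy x _ ↦ hΓ.adj_smul_of_notMem_compl_fixedBy hy x)

lemma eight_le_ncard [Finite V] (hΓ : IsAutAction G Γ) {t : G} (ht : t ^ 4 = 1)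
    (ht2 : t * t ≠ 1) : 8 ≤ (fixedBy V (t * t))ᶜ.ncard :=
  hΓ.two_mul_le_ncard (t := t) (n := 4) (by norm_num) (hΓ.compl_fixedBy_nonempty ht2)
    (fun x hx ↦ smul_mem_compl_fixedBy hx) (fun x ↦ minimalPeriod_of_four ht)
    (fun y hy x _ ↦ hΓ.adj_smul_of_notMem_compl_fixedBy hy x)

/-- If the order of the generator `g` has only the prime divisors `p` and `q`, then the sets of
vertices moved by the subgroups of order `p` and `q` are disjoint. -/
lemma card_lt_of_cyclic [Finite V] (hΓ : IsAutAction G Γ) {g : G} {p q : ℕ}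
    (hg : ∀ x, x ∈ Subgroup.zpowers g) (hprime : ∀ r, r.Prime → r ∣ orderOf g → r = p ∨ r = q)
    (h2 : ¬ orderOf g ∣ 2)
    (h : orderOf g < (fixedBy V (g ^ (orderOf g / p)))ᶜ.ncard +
      (fixedBy V (g ^ (orderOf g / q)))ᶜ.ncard) : Nat.card G < Nat.card V := by
  by_contra! hcard
  have hcard' : Nat.card G = orderOf g := (orderOf_eq_card_of_forall_mem_zpowers hg).symm
  rw [hcard'] at hcard
  rw [orderOf_dvd_iff_pow_eq_one, pow_two] at h2
  have hdisj : Disjoint (fixedBy V (g ^ (orderOf g / p)))ᶜ (fixedBy V (g ^ (orderOf g / q)))ᶜ := by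
    refine Set.disjoint_left.2 fun x hxp hxq ↦ ?_
    obtain ⟨h, h1, hx⟩ := hΓ.exists_ne_one_smul_eq (hcard.trans_eq hcard'.symm) h2 x
    obtain ⟨k, rfl⟩ := hg h
    simp only at hx h1
    set d := Function.minimalPeriod (g • ·) x with hd
    obtain ⟨e, he⟩ : d ∣ orderOf g := (isPeriodicPt_smul (pow_orderOf_eq_one g)).minimalPeriod_dvd
    have he1 : e ≠ 1 := by
      rintro rfl
      rw [zpow_smul_eq_iff_minimalPeriod_dvd, ← hd, ← mul_one d, ← he, orderOf_dvd_iff_zpow_eq_one]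
        at hx
      exact h1 hx
    have hfix {r : ℕ} (hr : r ∣ e) : x ∈ fixedBy V (g ^ (orderOf g / r)) := by
      rw [mem_fixedBy, pow_smul_eq_iff_minimalPeriod_dvd, he, Nat.mul_div_assoc _ hr]
      exact dvd_mul_right _ _
    obtain h' | h' := hprime e.minFac (Nat.minFac_prime he1)
      ((Nat.minFac_dvd e).trans (he ▸ dvd_mul_left _ _))
    · exact hxp (h' ▸ hfix (Nat.minFac_dvd e))
    · exact hxq (h' ▸ hfix (Nat.minFac_dvd e))
  rw [← Set.ncard_union_eq hdisj] at h
  exact absurd (h.trans_le (Set.ncard_le_card _)) hcard.not_gt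

lemma pow_orderOf_div {g : G} {n : ℕ} (hg : orderOf g ≠ 0) (hn : n ∣ orderOf g) (hn1 : n ≠ 1) :
    (g ^ (orderOf g / n)) ^ n = 1 ∧ g ^ (orderOf g / n) ≠ 1 := by
  have h := orderOf_pow_orderOf_div hg hn
  refine ⟨?_, fun h1 ↦ hn1 ?_⟩
  · rw [← pow_mul, Nat.div_mul_cancel hn, pow_orderOf_eq_one]
  · rw [← h, h1, orderOf_one]

lemma eight_le_ncard_of_four_dvd [Finite V] (hΓ : IsAutAction G Γ) {g : G}
    (hg : orderOf g ≠ 0) (h4 : 4 ∣ orderOf g) :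
    8 ≤ (fixedBy V (g ^ (orderOf g / 2)))ᶜ.ncard := by
  have h : g ^ (orderOf g / 2) = g ^ (orderOf g / 4) * g ^ (orderOf g / 4) := by
    rw [← pow_add]
    congr 1
    omega
  have h2 := (pow_orderOf_div hg ((by norm_num : 2 ∣ 4).trans h4) (by norm_num)).2
  rw [h] at h2 ⊢
  exact hΓ.eight_le_ncard (pow_orderOf_div hg h4 (by norm_num)).1 h2

lemma card_lt_of_two_mul_prime [Finite V] [IsCyclic G] (hΓ : IsAutAction G Γ) {p : ℕ}
    (hp : p.Prime) (hp2 : p ≠ 2) (hG : Nat.card G = 2 * p) : Nat.card G < Nat.card V := by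
  obtain ⟨g, hg⟩ := IsCyclic.exists_generator (α := G)
  have ho : orderOf g = 2 * p := (orderOf_eq_card_of_forall_mem_zpowers hg).trans hG
  have h0 : orderOf g ≠ 0 := by have := hp.pos; omega
  refine hΓ.card_lt_of_cyclic (p := 2) (q := p) hg (fun r hr h ↦ ?_) (fun h ↦ ?_) ?_
  · rw [ho, hr.dvd_mul, Nat.prime_dvd_prime_iff_eq hr Nat.prime_two,
      Nat.prime_dvd_prime_iff_eq hr hp] at h
    exact h
  · have := Nat.le_of_dvd (by norm_num) h
    have := hp.two_le
    omega
  · have h1 := pow_orderOf_div h0 (ho ▸ dvd_mul_right 2 p) (by norm_num)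
    have h2 := pow_orderOf_div h0 (ho ▸ dvd_mul_left p 2) hp.ne_one
    have h3 := (Set.ncard_pos).2 (hΓ.compl_fixedBy_nonempty h1.2)
    have h4 := hΓ.two_mul_prime_le_ncard hp hp2 h2.1 h2.2
    omega

lemma card_lt_of_cyclic_exceptional [Finite V] [IsCyclic G] (hΓ : IsAutAction G Γ)
    (hG : Nat.card G = 12 ∨ Nat.card G = 15 ∨ Nat.card G = 20 ∨ Nat.card G = 21) :
    Nat.card G < Nat.card V := by
  obtain ⟨g, hg⟩ := IsCyclic.exists_generator (α := G)
  rw [← orderOf_eq_card_of_forall_mem_zpowers hg] at hG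
  have h0 : orderOf g ≠ 0 := by omega
  have h3 (h : 3 ∣ orderOf g) : 9 ≤ (fixedBy V (g ^ (orderOf g / 3)))ᶜ.ncard := by
    have := pow_orderOf_div h0 h (by norm_num)
    exact hΓ.three_mul_prime_le_ncard (.inl rfl) this.1 this.2
  have h5 (h : 5 ∣ orderOf g) : 15 ≤ (fixedBy V (g ^ (orderOf g / 5)))ᶜ.ncard := by
    have := pow_orderOf_div h0 h (by norm_num)
    exact hΓ.three_mul_prime_le_ncard (.inr rfl) this.1 this.2
  have h7 (h : 7 ∣ orderOf g) : 14 ≤ (fixedBy V (g ^ (orderOf g / 7)))ᶜ.ncard := by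
    have := pow_orderOf_div h0 h (by norm_num)
    exact hΓ.two_mul_prime_le_ncard (by norm_num) (by norm_num) this.1 this.2
  have h4 := hΓ.eight_le_ncard_of_four_dvd h0
  have hdvd {m n : ℕ} (hm : m.Prime) (hn : n.Prime) {r : ℕ} (hr : r.Prime) (h : r ∣ m * n) :
      r = m ∨ r = n := by
    rwa [hr.dvd_mul, Nat.prime_dvd_prime_iff_eq hr hm, Nat.prime_dvd_prime_iff_eq hr hn] at h
  have h2 : ¬ orderOf g ∣ 2 := fun h ↦ by
    have := Nat.le_of_dvd (by norm_num) h
    omega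
  obtain h | h | h | h := hG
  · refine hΓ.card_lt_of_cyclic (p := 2) (q := 3) hg (fun r hr hdvd' ↦ ?_) h2
      (by have := h4 (by omega); have := h3 (by omega); omega)
    rw [h, (by norm_num : 12 = 2 * (2 * 3)), hr.dvd_mul,
      Nat.prime_dvd_prime_iff_eq hr Nat.prime_two] at hdvd'
    exact hdvd'.elim .inl (hdvd Nat.prime_two Nat.prime_three hr)
  · exact hΓ.card_lt_of_cyclic (p := 3) (q := 5) hg
      (fun r hr h' ↦ hdvd Nat.prime_three Nat.prime_five hr (h'.trans (by rw [h]))) h2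
      (by have := h5 (by omega); have := h3 (by omega); omega)
  · refine hΓ.card_lt_of_cyclic (p := 2) (q := 5) hg (fun r hr hdvd' ↦ ?_) h2
      (by have := h4 (by omega); have := h5 (by omega); omega)
    rw [h, (by norm_num : 20 = 2 * (2 * 5)), hr.dvd_mul,
      Nat.prime_dvd_prime_iff_eq hr Nat.prime_two] at hdvd'
    exact hdvd'.elim .inl (hdvd Nat.prime_two Nat.prime_five hr)
  · exact hΓ.card_lt_of_cyclic (p := 3) (q := 7) hg
      (fun r hr h' ↦ hdvd Nat.prime_three (by norm_num) hr (h'.trans (by rw [h]))) h2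
      (by have := h3 (by omega); have := h7 (by omega); omega)

/-- Two points whose stabilizers generate `G` have a uniform adjacency. -/
lemma adj_smul_of_sup_eq_top (hΓ : IsAutAction G Γ) {x y : V}
    (h : stabilizer G y ⊔ stabilizer G x = ⊤) (g : G) : Γ.Adj y (g • x) ↔ Γ.Adj y x := by
  obtain ⟨u, hu, v, hv, rfl⟩ := Subgroup.mem_sup.1 (h ▸ Subgroup.mem_top g)
  rw [mul_smul, mem_stabilizer_iff.1 hv, hΓ.adj_smul_right_iff hu]

lemma stabilizer_smul_eq (g : G) (x : V) : stabilizer G (g • x) = stabilizer G x := by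
  ext h
  rw [mem_stabilizer_iff, mem_stabilizer_iff, smul_comm, smul_left_cancel_iff]

lemma card_lt_of_elementary [Finite V] (hΓ : IsAutAction G Γ) {p : ℕ} (hp : p = 3 ∨ p = 5)
    (hG : Nat.card G = p * p) (hexp : ∀ g : G, g ^ p = 1) : Nat.card G < Nat.card V := by
  by_contra! hcard
  have hp' : p.Prime := by rcases hp with rfl | rfl <;> norm_num
  have : Finite G := Nat.finite_of_card_ne_zero (by rw [hG]; exact (mul_pos hp'.pos hp'.pos).ne')
  have : Nontrivial G := (Finite.one_lt_card_iff_nontrivial).1 (by rw [hG]; nlinarith [hp'.two_le])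
  obtain ⟨g₀, hg₀⟩ := exists_ne (1 : G)
  have hsq : g₀ * g₀ ≠ 1 := fun h ↦ hg₀ <| orderOf_eq_one_iff.1 <| Nat.eq_one_of_dvd_coprimes
    (by rcases hp with rfl | rfl <;> norm_num : Nat.Coprime 2 p)
    (orderOf_dvd_of_pow_eq_one (by rw [pow_two, h])) (orderOf_dvd_of_pow_eq_one (hexp g₀))
  have hbot (x : V) : stabilizer G x ≠ ⊥ := fun h ↦ by
    obtain ⟨g, hg, hgx⟩ := hΓ.exists_ne_one_smul_eq hcard hsq x
    exact hg ((Subgroup.eq_bot_iff_forall _).1 h g hgx)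
  have hcardK (K : Subgroup G) (h1 : K ≠ ⊥) (h2 : K ≠ ⊤) : Nat.card K = p := by
    have hd : Nat.card K ∣ p ^ 2 := by rw [pow_two, ← hG]; exact K.card_subgroup_dvd_card
    obtain ⟨i, hi, h⟩ := (Nat.dvd_prime_pow hp').1 hd
    obtain rfl | rfl | rfl : i = 0 ∨ i = 1 ∨ i = 2 := by omega
    · exact absurd (K.card_eq_one.1 (by simpa using h)) h1
    · simpa using h
    · exact absurd (K.card_eq_iff_eq_top.1 (by rw [h, hG, pow_two])) h2
  have hsup {K L : Subgroup G} (hK : K ≠ ⊥) (hL : L ≠ ⊥) (hKL : L ≠ K) : L ⊔ K = ⊤ := by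
    by_contra h
    have hLK := hcardK _ (fun h' ↦ hK (eq_bot_iff.2 (h' ▸ le_sup_right))) h
    have hK' := hcardK K hK fun h' ↦ h (by rw [h', sup_top_eq])
    have hL' := hcardK L hL fun h' ↦ h (by rw [h', top_sup_eq])
    exact hKL ((Subgroup.eq_of_le_of_card_ge le_sup_left (by omega)).trans
      (Subgroup.eq_of_le_of_card_ge le_sup_right (by omega)).symm)
  have key (x : V) (hx : stabilizer G x ≠ ⊤) :
      3 * p ≤ {y : V | stabilizer G y = stabilizer G x}.ncard := by
    obtain ⟨t, ht⟩ : ∃ t, t ∉ stabilizer G x := by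
      by_contra! h
      exact hx (Subgroup.eq_top_iff' _ |>.2 h)
    refine hΓ.three_mul_le_ncard (t := t) (by omega) ⟨x, rfl⟩
      (fun y hy g ↦ (stabilizer_smul_eq g y).trans hy)
      (fun y hy ↦ minimalPeriod_of_prime hp' (hexp t) fun h ↦ ht (hy ▸ h)) (fun y hy z hz ↦ ?_)
    refine hΓ.adj_smul_of_sup_eq_top ?_ t
    rw [show stabilizer G z = _ from hz]
    exact hsup (hbot x) (hbot y) hy
  obtain ⟨x, hx⟩ := hΓ.exists_smul_ne hg₀
  have hxt : stabilizer G x ≠ ⊤ := fun h ↦ hx (mem_stabilizer_iff.1 (h ▸ Subgroup.mem_top g₀))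
  obtain ⟨⟨k, hk⟩, hk1⟩ := Subgroup.ne_bot_iff_exists_ne_one.1 (hbot x)
  obtain ⟨y, hy⟩ := hΓ.exists_smul_ne (g := k) fun h ↦ hk1 (Subtype.ext h)
  have hyt : stabilizer G y ≠ ⊤ := fun h ↦
    hy (mem_stabilizer_iff.1 (h ▸ Subgroup.mem_top k))
  have hxy : stabilizer G x ≠ stabilizer G y := fun h ↦ hy (mem_stabilizer_iff.1 (h ▸ hk))
  have hdisj : Disjoint {z : V | stabilizer G z = stabilizer G x}
      {z : V | stabilizer G z = stabilizer G y} :=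
    Set.disjoint_left.2 fun z hz hz' ↦ hxy (Eq.trans (Eq.symm hz) hz')
  have h := Set.ncard_le_card ({z : V | stabilizer G z = stabilizer G x} ∪
    {z : V | stabilizer G z = stabilizer G y})
  rw [Set.ncard_union_eq hdisj] at h
  have := key x hxt
  have := key y hyt
  rw [hG] at hcard
  rcases hp with rfl | rfl <;> omega

lemma card_lt_of_two_four [Finite V] (hΓ : IsAutAction G Γ) (hG : Nat.card G = 8) {t : G}
    (ht : t ^ 4 = 1) (ht2 : t * t ≠ 1) (hsq : ∀ g : G, g * g = 1 ∨ g * g = t * t)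
    (hinv : ∀ u v : G, u * u = 1 → v * v = 1 → u ≠ 1 → v ≠ 1 → u ≠ t * t → v ≠ t * t →
      v = u ∨ v = t * t * u) : Nat.card G < Nat.card V := by
  by_contra! hcard
  have hstab (z : V) : z ∈ fixedBy V (t * t) ∨
      ∃ h : G, h * h = 1 ∧ h ≠ 1 ∧ h ≠ t * t ∧ h • z = z := by
    obtain ⟨h, h1, hz⟩ := hΓ.exists_ne_one_smul_eq hcard ht2 z
    by_cases hht : h = t * t
    · exact .inl (hht ▸ hz)
    · obtain h2 | h2 := hsq h
      · exact .inr ⟨h, h2, h1, hht, hz⟩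
      · left
        rw [mem_fixedBy, ← h2, mul_smul, hz, hz]
  obtain ⟨x, hx⟩ := hΓ.exists_smul_ne ht2
  obtain ⟨h, h2, h1, hht, hhx⟩ := (hstab x).resolve_left hx
  let T : Set V := fixedBy V h ∩ (fixedBy V (t * t))ᶜ
  have hT : 2 * 4 ≤ T.ncard := by
    refine hΓ.two_mul_le_ncard (t := t) (by norm_num) ⟨x, hhx, hx⟩
      (fun y hy g ↦ ⟨?_, smul_mem_compl_fixedBy hy.2 g⟩)
      (fun y hy ↦ minimalPeriod_of_four ht hy.2) (fun z hz y hy ↦ ?_)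
    · rw [mem_fixedBy, smul_comm, hy.1]
    · obtain hz' | ⟨k, k2, k1, hkt, hkz⟩ := hstab z
      · exact hΓ.adj_smul_right_iff hz' y
      obtain rfl | rfl := hinv h k h2 k2 h1 k1 hht hkt
      · exact hΓ.adj_smul_right_iff (not_not.1 fun h' ↦ hz ⟨hkz, h'⟩) y
      · rw [← hΓ.adj_smul_right_iff hkz y, mul_smul _ h, hy.1]
  have huniv : T = Set.univ := by
    refine Set.eq_univ_of_forall fun z ↦ ?_
    by_contra hz
    have := Set.ncard_lt_card (s := T) fun h ↦ hz (h ▸ Set.mem_univ z)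
    omega
  refine h1 (hΓ.eq_one h fun z ↦ ?_)
  exact (huniv ▸ Set.mem_univ z : z ∈ T).1

lemma card_lt_of_four_four [Finite V] (hΓ : IsAutAction G Γ) (hG : Nat.card G = 16)
    (hexp : ∀ g : G, g ^ 4 = 1) {g₀ : G} (hg₀ : g₀ * g₀ ≠ 1)
    (hinv : ∀ u v w : G, u * u = 1 → v * v = 1 → w * w = 1 → u ≠ 1 → v ≠ 1 → u ≠ v →
      w = 1 ∨ w = u ∨ w = v ∨ w = v * u)
    (hsqrt : ∀ u : G, u * u = 1 → ∃ t, t * t = u) : Nat.card G < Nat.card V := by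
  by_contra! hcard
  have : Finite G := Nat.finite_of_card_ne_zero (by rw [hG]; norm_num)
  have hsq (g : G) : g * g * (g * g) = 1 := by
    rw [← pow_two, ← pow_two, ← pow_mul, hexp]
  have hstab (z : V) : ∃ u : G, u * u = 1 ∧ u ≠ 1 ∧ u • z = z := by
    obtain ⟨h, h1, hz⟩ := hΓ.exists_ne_one_smul_eq hcard hg₀ z
    by_cases hh : h * h = 1
    · exact ⟨h, hh, h1, hz⟩
    · exact ⟨h * h, hsq h, hh, by rw [mul_smul, hz, hz]⟩
  let T (u : G) : Set V := {z | u • z = z ∧ ∃ w : G, w * w = 1 ∧ w • z ≠ z}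
  have hTsmul {u : G} {z : V} (hz : z ∈ T u) (g : G) : g • z ∈ T u := by
    obtain ⟨h, w, hw, hwz⟩ := hz
    exact ⟨by rw [smul_comm, h], w, hw, by rwa [smul_comm, ne_eq, smul_left_cancel_iff]⟩
  have hTeq {u v : G} (hu : u * u = 1) (hu1 : u ≠ 1) {z : V} (hz : z ∈ T u) (hv : v * v = 1)
      (hv1 : v ≠ 1) (hvz : v • z = z) : v = u := by
    by_contra hne
    obtain ⟨h, w, hw, hwz⟩ := hz
    apply hwz
    obtain rfl | rfl | rfl | rfl := hinv u v w hu hv hw hu1 hv1 (Ne.symm hne)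
    · exact one_smul _ _
    · exact h
    · exact hvz
    · rw [mul_smul, h, hvz]
  have horb {u : G} {z : V} (hz : z ∈ T u) : 4 ≤ (orbit G z).ncard := by
    obtain ⟨h, w, hw, hwz⟩ := hz
    obtain ⟨t, rfl⟩ := hsqrt w hw
    rw [← minimalPeriod_of_four (hexp t) hwz, ← ncard_orbit_zpowers]
    refine Set.ncard_le_ncard ?_
    rintro _ ⟨g, rfl⟩
    exact mem_orbit z (g : G)
  have horbT {u : G} {z : V} (hz : z ∈ T u) : orbit G z ⊆ T u := by
    rintro _ ⟨g, rfl⟩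
    exact hTsmul hz g
  have hT {u : G} (hu : u * u = 1) (hu1 : u ≠ 1) {a : V} (ha : a ∈ T u) :
      (orbit G a).ncard + 4 ≤ (T u).ncard := by
    obtain ⟨b, hb, hba⟩ : ∃ b ∈ T u, b ∉ orbit G a := by
      by_contra! hsub
      have h2 (g : G) : g • g • a = a := by
        refine hΓ.smul_smul_eq_of_orbit ⊤ (fun y hy g _ ↦ ?_) (Subgroup.mem_top g)
        have hyT : y ∉ T u := fun h ↦ by
          obtain ⟨g, rfl⟩ := hsub y h
          exact hy g (Subgroup.mem_top g) rfl
        have hg : (g⁻¹ * g⁻¹) • g • a = g⁻¹ • a := by rw [smul_smul, inv_mul_cancel_right]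
        rw [← hg]
        suffices h : ∀ w : G, w * w = 1 → (Γ.Adj y (w • g • a) ↔ Γ.Adj y (g • a)) from
          (h _ (hsq _)).2
        intro w hw
        by_cases hyw : ∀ w : G, w * w = 1 → w • y = y
        · exact hΓ.adj_smul_right_iff (hyw w hw) _
        push Not at hyw
        obtain ⟨v, hv, hv1, hvy⟩ := hstab y
        have huv : u ≠ v := by
          rintro rfl
          exact hyT ⟨hvy, hyw⟩
        have hug := (hTsmul ha g).1
        obtain rfl | rfl | rfl | rfl := hinv u v w hu hv hw hu1 hv1 huv
        · rw [one_smul]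
        · rw [hug]
        · exact hΓ.adj_smul_right_iff hvy _
        · rw [mul_smul, hug]
          exact hΓ.adj_smul_right_iff hvy _
      obtain ⟨-, w, hw, hwa⟩ := ha
      obtain ⟨t, rfl⟩ := hsqrt w hw
      exact hwa (by rw [mul_smul, h2])
    have hdisj := (orbit.eq_or_disjoint (G := G) a b).resolve_left fun h ↦
      hba (h ▸ mem_orbit_self b)
    have := Set.ncard_le_ncard (Set.union_subset (horbT ha) (horbT hb))
    rw [Set.ncard_union_eq hdisj] at this
    have := horb hb
    omega
  obtain ⟨a, ha⟩ := hΓ.exists_smul_ne hg₀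
  obtain ⟨u, hu, hu1, hua⟩ := hstab a
  have haT : a ∈ T u := ⟨hua, _, hsq _, ha⟩
  obtain ⟨b, hb⟩ := hΓ.exists_smul_ne hu1
  obtain ⟨v, hv, hv1, hvb⟩ := hstab b
  have hbT : b ∈ T v := ⟨hvb, u, hu, hb⟩
  have hvu : v ≠ u := by
    rintro rfl
    exact hb hvb
  have hdisj : Disjoint (T u) (T v) := Set.disjoint_left.2 fun z hz hz' ↦
    hvu (hTeq hu hu1 hz hv hv1 hz'.1)
  have hcardT := Set.ncard_union_eq hdisj
  have hle := Set.ncard_le_card (T u ∪ T v)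
  have hu8 {c : V} (hc : c ∈ T u) := And.intro (hT hu hu1 hc) (horb hc)
  have hv8 {c : V} (hc : c ∈ T v) := And.intro (hT hv hv1 hc) (horb hc)
  have huniv : T u ∪ T v = Set.univ := by
    refine Set.eq_univ_of_forall fun z ↦ ?_
    by_contra hz
    have := Set.ncard_lt_card (s := T u ∪ T v) fun h ↦ hz (h ▸ Set.mem_univ z)
    have := hu8 haT
    have := hv8 hbT
    omega
  have hstab4 (c : V) (hc : c ∈ T u ∪ T v) : 4 ≤ Nat.card (stabilizer G c) := by
    have h := (stabilizer G c).index_mul_card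
    rw [index_stabilizer, hG] at h
    have : (orbit G c).ncard ≤ 4 := by
      have := hu8 haT
      have := hv8 hbT
      obtain hc | hc := hc
      · have := hu8 hc
        omega
      · have := hv8 hc
        omega
    nlinarith
  have hsup {x y : V} (hx : x ∈ T u) (hy : y ∈ T v) : stabilizer G y ⊔ stabilizer G x = ⊤ := by
    have hd : Disjoint (stabilizer G y) (stabilizer G x) := by
      rw [Subgroup.disjoint_def]
      intro k hky hkx
      have hk (k : G) (hkk : k * k = 1) (hky : k • y = y) (hkx : k • x = x) : k = 1 := by
        by_contra hk1
        exact hvu ((hTeq hv hv1 hy hkk hk1 hky).symm.trans (hTeq hu hu1 hx hkk hk1 hkx))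
      rw [mem_stabilizer_iff] at hky hkx
      exact hk k (hk _ (hsq k) (by rw [mul_smul, hky, hky]) (by rw [mul_smul, hkx, hkx])) hky hkx
    have hinj := Subgroup.mul_injective_of_disjoint hd
    have hsurj := (hinj.bijective_of_nat_card_le (by
      rw [Nat.card_prod, hG]
      have := hstab4 x (.inl hx)
      have := hstab4 y (.inr hy)
      nlinarith)).2
    refine (Subgroup.eq_top_iff' _).2 fun g ↦ ?_
    obtain ⟨⟨k, l⟩, rfl⟩ := hsurj g
    exact Subgroup.mul_mem_sup k.2 l.2
  obtain ⟨t, rfl⟩ := hsqrt v hv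
  have h12 : 3 * 4 ≤ (T u).ncard := by
    refine hΓ.three_mul_le_ncard (t := t) (by norm_num) ⟨a, haT⟩ (fun x hx g ↦ hTsmul hx g)
      (fun x hx ↦ minimalPeriod_of_four (hexp t) fun h ↦ hvu (hTeq hu hu1 hx hv hv1 h))
      (fun y hy x hx ↦ hΓ.adj_smul_of_sup_eq_top (hsup hx ?_) t)
    exact (huniv ▸ Set.mem_univ y : y ∈ T u ∪ T (t * t)).resolve_left hy
  have := hv8 hbT
  omega

end IsAutAction

lemma graphAlpha_congr {G H : Type*} [Group G] [Group H] (e : G ≃* H) :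
    graphAlpha G = graphAlpha H := by
  unfold graphAlpha
  congr 1
  ext n
  exact ⟨fun h ↦ Realizes.congr h e, fun h ↦ Realizes.congr h e.symm⟩

lemma coprime_of_isCyclic_prod_zmod {q r : ℕ}
    (h : IsCyclic (Multiplicative (ZMod q × ZMod r))) : q.Coprime r := by
  rw [isCyclic_multiplicative_iff, AddGroup.isAddCyclic_prod_iff] at h
  simpa using h.2.2

lemma card_lt_graphAlpha_of_excCyclic {q r : ℕ} (hq : 2 ≤ q) (hr : 2 ≤ r)
    (h : ExcCyclic (Multiplicative (ZMod q × ZMod r))) :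
    Nat.card (Multiplicative (ZMod q × ZMod r)) <
      graphAlpha (Multiplicative (ZMod q × ZMod r)) := by
  obtain ⟨hc, -, h⟩ := h
  have hcop := coprime_of_isCyclic_prod_zmod hc
  have not_prime_pow (p k : ℕ) (hp : p.Prime) :
      Nat.card (Multiplicative (ZMod q × ZMod r)) ≠ p ^ k := fun h ↦ by
    rw [card_multiplicative_prod_zmod] at h
    have hdvd {m : ℕ} (hm : 2 ≤ m) (h : m ∣ p ^ k) : p ∣ m := by
      obtain ⟨i, -, rfl⟩ := (Nat.dvd_prime_pow hp).1 h
      refine dvd_pow_self p ?_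
      rintro rfl
      simp at hm
    exact hp.not_dvd_one (hcop ▸ Nat.dvd_gcd (hdvd hq (h ▸ dvd_mul_right q r))
      (hdvd hr (h ▸ dvd_mul_left r q)))
  obtain ⟨p, k, hp, -, h⟩ | ⟨p, hp, h⟩ := h
  · exact absurd h (not_prime_pow p k hp)
  · have hp2 : p ≠ 2 := by
      rintro rfl
      exact not_prime_pow 2 2 Nat.prime_two h
    refine card_lt_graphAlpha (exists_realizes_prod_zmod hq hr) fun n _ Γ hΓ ↦ ?_
    simpa using hΓ.card_lt_of_two_mul_prime hp hp2 h

lemma card_lt_graphAlpha_of_mulEquiv_cyc {G : Type*} [CommGroup G] {n : ℕ}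
    (hn : n = 12 ∨ n = 15 ∨ n = 20 ∨ n = 21) (hG : ∃ n, Realizes n G) (e : G ≃* Cyc n) :
    Nat.card G < graphAlpha G := by
  have : IsCyclic G := isCyclic_of_surjective e.symm e.symm.surjective
  have hc : Nat.card G = n := by
    rw [Nat.card_congr e.toEquiv, Nat.card_congr Multiplicative.toAdd, Nat.card_zmod]
  refine card_lt_graphAlpha hG fun n _ Γ hΓ ↦ ?_
  simpa using hΓ.card_lt_of_cyclic_exceptional (hc ▸ hn)

set_option synthInstance.maxSize 1000 in
lemma card_lt_graphAlpha_two_four :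
    Nat.card (Multiplicative (ZMod 2 × ZMod 4)) <
      graphAlpha (Multiplicative (ZMod 2 × ZMod 4)) := by
  refine card_lt_graphAlpha (exists_realizes_prod_zmod le_rfl (by norm_num)) fun n _ Γ hΓ ↦ ?_
  simpa using hΓ.card_lt_of_two_four (card_multiplicative_prod_zmod 2 4)
    (t := Multiplicative.ofAdd (0, 1)) (by decide) (by decide) (by decide) (by decide +kernel)

set_option synthInstance.maxSize 1000 in
lemma card_lt_graphAlpha_four_four :
    Nat.card (Multiplicative (ZMod 4 × ZMod 4)) <
      graphAlpha (Multiplicative (ZMod 4 × ZMod 4)) := by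
  refine card_lt_graphAlpha (exists_realizes_prod_zmod (by norm_num) (by norm_num))
    fun n _ Γ hΓ ↦ ?_
  simpa using hΓ.card_lt_of_four_four (card_multiplicative_prod_zmod 4 4)
    (by decide) (g₀ := Multiplicative.ofAdd (0, 1)) (by decide) (by decide +kernel)
    (by decide +kernel)

lemma card_lt_graphAlpha_prime_prime {p : ℕ} (hp : p = 3 ∨ p = 5) :
    Nat.card (Multiplicative (ZMod p × ZMod p)) <
      graphAlpha (Multiplicative (ZMod p × ZMod p)) := by
  refine card_lt_graphAlpha (exists_realizes_prod_zmod (by omega) (by omega)) fun n _ Γ hΓ ↦ ?_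
  simpa using hΓ.card_lt_of_elementary hp (card_multiplicative_prod_zmod p p) fun g ↦ by
    apply Multiplicative.toAdd.injective
    ext <;> simp

lemma card_lt_graphAlpha_of_excEight {G : Type*} [CommGroup G] (hG : ∃ n, Realizes n G)
    (h : ExcEight G) : Nat.card G < graphAlpha G := by
  have transfer {H : Type} [Group H] (e : G ≃* H) (h : Nat.card H < graphAlpha H) :
      Nat.card G < graphAlpha G := by
    rwa [graphAlpha_congr e, Nat.card_congr e.toEquiv]
  obtain ⟨⟨e⟩⟩ | ⟨⟨e⟩⟩ | ⟨⟨e⟩⟩ | ⟨⟨e⟩⟩ | ⟨⟨e⟩⟩ | ⟨⟨e⟩⟩ | ⟨⟨e⟩⟩ | ⟨⟨e⟩⟩ := h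
  · exact card_lt_graphAlpha_of_mulEquiv_cyc (by simp) hG e
  · exact card_lt_graphAlpha_of_mulEquiv_cyc (by simp) hG e
  · exact card_lt_graphAlpha_of_mulEquiv_cyc (by simp) hG e
  · exact card_lt_graphAlpha_of_mulEquiv_cyc (by simp) hG e
  · exact transfer e card_lt_graphAlpha_two_four
  · exact transfer e (card_lt_graphAlpha_prime_prime (.inl rfl))
  · exact transfer e card_lt_graphAlpha_four_four
  · exact transfer e (card_lt_graphAlpha_prime_prime (.inr rfl))

/-- Lemma: for `G = C_{q₁} × C_{q₂}` with `q₁ ≤ q₂` prime powers, either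
`α(G) ≤ |G|`, or `G` is one of the specified exceptions, in which case
`α(G) > |G|`. -/
theorem prod_two_cyclic_alpha_le_card_iff_not_exceptional
    (q₁ q₂ : ℕ) (h₁ : IsPrimePow q₁) (h₂ : IsPrimePow q₂) (hle : q₁ ≤ q₂) :
    (¬ ExcCyclic (Multiplicative (ZMod q₁ × ZMod q₂)) ∧
        ¬ ExcEight (Multiplicative (ZMod q₁ × ZMod q₂)) →
      graphAlpha (Multiplicative (ZMod q₁ × ZMod q₂)) ≤
        Nat.card (Multiplicative (ZMod q₁ × ZMod q₂))) ∧
    (ExcCyclic (Multiplicative (ZMod q₁ × ZMod q₂)) ∨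
        ExcEight (Multiplicative (ZMod q₁ × ZMod q₂)) →
      graphAlpha (Multiplicative (ZMod q₁ × ZMod q₂)) >
        Nat.card (Multiplicative (ZMod q₁ × ZMod q₂))) := by
  refine ⟨fun h ↦ ?_, fun h ↦ ?_⟩
  · rw [card_multiplicative_prod_zmod]
    exact graphAlpha_le_of_not_exceptional h₁ h₂ hle h.1 h.2
  · obtain h | h := h
    · exact card_lt_graphAlpha_of_excCyclic h₁.two_le h₂.two_le h
    · exact card_lt_graphAlpha_of_excEight (exists_realizes_prod_zmod h₁.two_le h₂.two_le) h
end

section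
/- Let G be a generalised dihedral group Dih(X) of order 2k, where k ≥ 6 and k ≠ 9, and suppose G is not isomorphic to C₂ × C₂ × C₂ × C₂. Then G admits a graphical regular representation, i.e. there exists an inverse-closed subset S ⊆ G \ {1} such that the automorphism group of the Cayley graph Cay(G, S) is isomorphic to G. -/
/-- `G` is generalised dihedral over an abelian subgroup `X` of index 2:
there is `b ∈ G \ X` with `b² = 1` inverting every element of `X`. -/
def IsGeneralizedDihedral (G : Type*) [Group G] : Prop :=
  ∃ (X : Subgroup G) (b : G), X.index = 2 ∧
    (∀ x ∈ X, ∀ y ∈ X, x * y = y * x) ∧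
    b ∉ X ∧ b ^ 2 = 1 ∧ ∀ a ∈ X, b * a * b⁻¹ = a⁻¹

section CayleyRigidity

variable {G : Type*} [Group G]

/-- `f` is an automorphism of `Cay(G, S)` fixing the identity. -/
structure IsCayleyStabilizer (S : Set G) (f : G ≃ G) : Prop where
  map_one : f 1 = 1
  map_mem_iff : ∀ x y, f x * (f y)⁻¹ ∈ S ↔ x * y⁻¹ ∈ S

/-- The stabilizer of the identity in the automorphism group of `Cay(G, S)` is trivial. -/
def IsCayleyRigid (S : Set G) : Prop :=
  ∀ f : G ≃ G, IsCayleyStabilizer S f → ∀ x, f x = x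

/-- `G` has a GRR of controlled valency each of whose edges lies in a triangle. -/
def HasTriangleGRR (G : Type*) [Group G] : Prop :=
  ∃ S : Set G, 1 ∉ S ∧ (∀ s ∈ S, s⁻¹ ∈ S) ∧ IsCayleyRigid S ∧
    (∀ s ∈ S, ∃ t ∈ S, t * s⁻¹ ∈ S) ∧ Subgroup.closure S = ⊤ ∧
    1 ≤ S.ncard ∧ S.ncard + 3 ≤ Nat.card G

namespace IsCayleyStabilizer

variable {S : Set G} {f : G ≃ G}

theorem mem_iff (hf : IsCayleyStabilizer S f) (x : G) : f x ∈ S ↔ x ∈ S := by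
  simpa [hf.map_one] using hf.map_mem_iff x 1

theorem symm (hf : IsCayleyStabilizer S f) : IsCayleyStabilizer S f.symm where
  map_one := by rw [Equiv.symm_apply_eq, hf.map_one]
  map_mem_iff x y := by
    have := hf.map_mem_iff (f.symm x) (f.symm y)
    simpa using this.symm

theorem translate (hf : IsCayleyStabilizer S f) (v : G) :
    IsCayleyStabilizer S ((Equiv.mulRight v).trans (f.trans (Equiv.mulRight (f v)⁻¹))) where
  map_one := by simp
  map_mem_iff x y := by
    have := hf.map_mem_iff (x * v) (y * v)
    simpa [mul_assoc] using this

end IsCayleyStabilizer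

theorem isCayleyRigid_of_closure_eq_top {S T : Set G} (hT : Subgroup.closure T = ⊤)
    (h : ∀ f : G ≃ G, IsCayleyStabilizer S f → ∀ t ∈ T, f t = t) : IsCayleyRigid S := by
  suffices H : ∀ x ∈ Subgroup.closure T, ∀ f : G ≃ G, IsCayleyStabilizer S f → f x = x from
    fun f hf x => H x (hT ▸ Subgroup.mem_top x) f hf
  intro x hx
  induction hx using Subgroup.closure_induction with
  | mem x hx => exact fun f hf => h f hf x hx
  | one => exact fun f hf => hf.map_one
  | mul u v _ _ hu hv =>
    intro f hf
    have := hu _ (hf.translate v)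
    simpa [hv f hf, mul_inv_eq_iff_eq_mul] using this
  | inv u _ hu =>
    intro f hf
    have := hu _ (hf.translate u⁻¹)
    simp only [Equiv.trans_apply, Equiv.coe_mulRight, mul_inv_cancel, hf.map_one, one_mul] at this
    exact inv_eq_iff_eq_inv.1 this

theorem exists_mul_eq_of_card_lt_two_mul_ncard [Finite G] {S : Set G}
    (h : Nat.card G < 2 * S.ncard) (x : G) : ∃ t ∈ S, ∃ u ∈ S, t = u * x := by
  have hc : ((fun u => u * x) '' S).ncard = S.ncard :=
    Set.ncard_image_of_injective _ (mul_left_injective x)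
  obtain ⟨t, ht, u, hu, rfl⟩ := Set.nonempty_inter_of_lt_ncard_add_ncard
    (s := S) (t := (fun u => u * x) '' S) (by omega)
  exact ⟨_, ht, u, hu, rfl⟩

theorem HasTriangleGRR.of_sparse [Finite G] {S : Set G} (h1 : 1 ∉ S)
    (hinv : ∀ s ∈ S, s⁻¹ ∈ S) (hS : IsCayleyRigid S) (h2 : 2 ≤ S.ncard)
    (hcard : 2 * S.ncard + 4 ≤ Nat.card G) : HasTriangleGRR G := by
  have hn : ((insert 1 S)ᶜ).ncard + (S.ncard + 1) = Nat.card G := by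
    rw [← Set.ncard_insert_of_notMem h1, add_comm]
    exact Set.ncard_add_ncard_compl _
  have key := exists_mul_eq_of_card_lt_two_mul_ncard (S := (insert 1 S)ᶜ) (by omega)
  refine ⟨(insert 1 S)ᶜ, by simp, ?_, ?_, ?_, ?_, by omega, by omega⟩
  · simp only [Set.mem_compl_iff, Set.mem_insert_iff, not_or]
    exact fun s hs => ⟨by simpa using hs.1, fun h => hs.2 (by simpa using hinv _ h)⟩
  · refine fun f hf => hS f ⟨hf.map_one, fun x y => ?_⟩
    have := hf.map_mem_iff x y
    simp only [Set.mem_compl_iff, Set.mem_insert_iff, mul_inv_eq_one, f.injective.eq_iff,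
      not_iff_not] at this
    by_cases hxy : x = y
    · simp [hxy]
    · simpa [hxy] using this
  · intro s _
    obtain ⟨t, ht, u, hu, rfl⟩ := key s
    exact ⟨_, ht, by simpa using hu⟩
  · refine eq_top_iff.2 fun x _ => ?_
    obtain ⟨t, ht, u, hu, h⟩ := key x
    obtain rfl : x = u⁻¹ * t := by simp [h]
    exact mul_mem (inv_mem (Subgroup.subset_closure hu)) (Subgroup.subset_closure ht)

theorem HasTriangleGRR.of_mulEquiv {H : Type*} [Group H] (e : G ≃* H) (h : HasTriangleGRR G) :
    HasTriangleGRR H := by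
  obtain ⟨S, h1, hinv, hS, htri, hgen, hpos, hcard⟩ := h
  have hn : (e.symm ⁻¹' S).ncard = S.ncard :=
    Set.ncard_preimage_of_injective_subset_range e.symm.injective
      (by simp [e.symm.surjective.range_eq])
  refine ⟨e.symm ⁻¹' S, by simpa using h1, fun s hs => by simpa using hinv _ hs, ?_, ?_, ?_,
    hn ▸ hpos, by rwa [hn, ← Nat.card_congr e.toEquiv]⟩
  · intro f hf x
    have := hS (e.toEquiv.trans (f.trans e.symm.toEquiv))
      ⟨by simp [hf.map_one], fun x y => by simpa using hf.map_mem_iff (e x) (e y)⟩ (e.symm x)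
    simpa using this
  · intro s hs
    obtain ⟨t, ht, hts⟩ := htri _ hs
    exact ⟨e t, by simpa using ht, by simpa using hts⟩
  · have := congrArg (Subgroup.map e.toMonoidHom) hgen
    rw [MonoidHom.map_closure, Subgroup.map_top_of_surjective _ e.surjective] at this
    rw [← this]
    congr 1
    ext x
    simp only [Set.mem_preimage, Set.mem_image]
    exact ⟨fun h => ⟨_, h, by simp⟩, by rintro ⟨y, hy, rfl⟩; simpa using hy⟩

theorem HasTriangleGRR.of_subgroup_of_involution [Finite G] {H : Subgroup G}
    (hH : HasTriangleGRR H) {t : G} (ht : t ∉ H) (ht2 : t * t = 1)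
    (hgen : Subgroup.closure (insert t (H : Set G)) = ⊤) : HasTriangleGRR G := by
  obtain ⟨S, h1, hinv, hS, htri, hSgen, hpos, hcard⟩ := hH
  have htinv : t⁻¹ = t := inv_eq_of_mul_eq_one_left ht2
  have hmem : ∀ x : H, (x : G) ∈ ((↑) '' S : Set G) ↔ x ∈ S := fun x => by simp
  have hsub : ∀ x ∈ ((↑) '' S : Set G), x ∈ H := by rintro _ ⟨x, -, rfl⟩; exact x.2
  have h1' : (1 : G) ∉ ((↑) '' S : Set G) := by simpa using (hmem 1).not.2 h1
  have hn : (insert t ((↑) '' S : Set G)).ncard = S.ncard + 1 := by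
    rw [Set.ncard_insert_of_notMem fun h => ht (hsub _ h),
      Set.ncard_image_of_injective _ Subtype.val_injective]
  have hidx : 2 * Nat.card H ≤ Nat.card G := by
    rw [← H.card_mul_index, mul_comm]
    refine Nat.mul_le_mul_left _ ?_
    have h0 : H.index ≠ 0 := H.index_ne_zero_of_finite
    have h1 : H.index ≠ 1 := fun h => ht (by simp [Subgroup.index_eq_one.1 h])
    omega
  have tri : ∀ x y : G, x * y⁻¹ ∈ ((↑) '' S : Set G) ↔ x * y⁻¹ ∈ insert t ((↑) '' S : Set G) ∧
      ∃ z, x * z⁻¹ ∈ insert t ((↑) '' S : Set G) ∧ z * y⁻¹ ∈ insert t ((↑) '' S : Set G) := by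
    intro x y
    constructor
    · rintro ⟨s, hs, h⟩
      obtain ⟨u, hu, hus⟩ := htri s hs
      refine ⟨Or.inr ⟨s, hs, h⟩, u * y, Or.inr ⟨_, hinv _ hus, ?_⟩, Or.inr ⟨u, hu, by simp⟩⟩
      simp [h, mul_assoc]
    · rintro ⟨h | h, z, hxz, hzy⟩
      · exfalso
        have hz : x * z⁻¹ * (z * y⁻¹) = t := by rw [← h]; group
        rcases hxz with hxz | hxz <;> rcases hzy with hzy | hzy
        · rw [hxz, hzy, ht2] at hz
          exact ht (hz ▸ H.one_mem)
        · rw [hxz, mul_eq_left] at hz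
          exact h1' (hz ▸ hzy)
        · rw [hzy, mul_eq_right] at hz
          exact h1' (hz ▸ hxz)
        · exact ht (hz ▸ H.mul_mem (hsub _ hxz) (hsub _ hzy))
      · exact h
  refine .of_sparse (S := insert t ((↑) '' S : Set G)) ?_ ?_ ?_ (by omega) (by omega)
  · rintro (h | h)
    · exact ht (h ▸ H.one_mem)
    · exact h1' h
  · rintro _ (rfl | ⟨s, hs, rfl⟩)
    · exact Or.inl htinv
    · exact Or.inr ⟨_, hinv s hs, rfl⟩
  · have hpres : ∀ f : G ≃ G, IsCayleyStabilizer (insert t ((↑) '' S : Set G)) f →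
        IsCayleyStabilizer ((↑) '' S : Set G) f := by
      refine fun f hf => ⟨hf.map_one, fun x y => ?_⟩
      rw [tri, tri, hf.map_mem_iff, f.surjective.exists]
      simp only [hf.map_mem_iff]
    have hmaps : ∀ f : G ≃ G, IsCayleyStabilizer ((↑) '' S : Set G) f → ∀ x : H, f x ∈ H := by
      intro f hf x
      have hx : x ∈ Subgroup.closure S := hSgen ▸ Subgroup.mem_top x
      induction hx using Subgroup.closure_induction_left with
      | one => simp [hf.map_one]
      | mul_left s hs y _ hy =>
        have := hsub _ ((hf.map_mem_iff (s * y : H) y).2 ⟨s, hs, by simp⟩)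
        simpa using H.mul_mem this hy
      | inv_mul_cancel s hs y _ hy =>
        have := hsub _ ((hf.map_mem_iff (s⁻¹ * y : H) y).2 ⟨s⁻¹, hinv s hs, by simp⟩)
        simpa using H.mul_mem this hy
    refine isCayleyRigid_of_closure_eq_top hgen fun f hf => ?_
    have hiff : ∀ x, x ∈ H ↔ f x ∈ H := fun x =>
      ⟨fun h => hmaps f (hpres f hf) ⟨x, h⟩, fun h => by
        simpa using hmaps f.symm (hpres f hf).symm ⟨_, h⟩⟩
    rintro x (rfl | hx)
    · rcases (hf.mem_iff x).2 (Or.inl rfl) with h | h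
      · exact h
      · exact absurd ((hiff x).2 (hsub _ h)) ht
    · have := hS (f.subtypeEquiv hiff) ⟨by ext; simp [hf.map_one], fun x y => by
        rw [← hmem, ← hmem]
        simpa using (hpres f hf).map_mem_iff x y⟩ ⟨x, hx⟩
      simpa using congrArg Subtype.val this

theorem HasTriangleGRR.of_subgroup_of_closure_involutions [Finite G]
    (hG : Subgroup.closure {t : G | t * t = 1} = ⊤) {H : Subgroup G} (hH : HasTriangleGRR H) :
    HasTriangleGRR G := by
  obtain ⟨K, -, hK⟩ := (Set.toFinite {K : Subgroup G | HasTriangleGRR K}).exists_le_maximal hH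
  by_cases hKtop : K = ⊤
  · subst hKtop
    exact hK.prop.of_mulEquiv Subgroup.topEquiv
  obtain ⟨t, ht2, ht⟩ : ∃ t : G, t * t = 1 ∧ t ∉ K := by
    by_contra! h
    exact hKtop (eq_top_iff.2 (hG ▸ (Subgroup.closure_le K).2 h))
  set L := Subgroup.closure (insert t (K : Set G)) with hL
  have hKL : K ≤ L := fun x hx => Subgroup.subset_closure (Or.inr hx)
  have htL : t ∈ L := Subgroup.subset_closure (Or.inl rfl)
  have hLgood : HasTriangleGRR L := by
    refine .of_subgroup_of_involution (H := K.subgroupOf L) (t := ⟨t, htL⟩)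
      (hK.prop.of_mulEquiv (Subgroup.subgroupOfEquivOfLe hKL).symm) ?_ ?_ ?_
    · simpa [Subgroup.mem_subgroupOf] using ht
    · ext; simpa using ht2
    · rw [← (Subgroup.closure_closure_coe_preimage (k := insert t (K : Set G)))]
      congr 1
      ext x
      simp [Subgroup.mem_subgroupOf, Subtype.ext_iff]
  exact absurd (hK.le_of_ge hLgood hKL htL) ht

theorem HasTriangleGRR.exists_cayleyGraph (h : HasTriangleGRR G) :
    ∃ S : Set G, (1 : G) ∉ S ∧ (∀ s ∈ S, s⁻¹ ∈ S) ∧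
      ∃ Γ : SimpleGraph G, (∀ x y : G, Γ.Adj x y ↔ x * y⁻¹ ∈ S) ∧
        Nonempty ((Γ ≃g Γ) ≃* G) := by
  obtain ⟨S, h1, hinv, hS, -⟩ := h
  let Γ : SimpleGraph G :=
    { Adj := fun x y => x * y⁻¹ ∈ S
      symm := ⟨fun x y h => by simpa using hinv _ h⟩
      loopless := ⟨fun x h => h1 (by simpa using h)⟩ }
  refine ⟨S, h1, hinv, Γ, fun x y => Iff.rfl, ?_⟩
  let Φ : G →* (Γ ≃g Γ) :=
    { toFun := fun g => ⟨Equiv.mulRight g⁻¹, fun {x y} => by simp [Γ]⟩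
      map_one' := by ext x; simp
      map_mul' := fun g h => by ext x; simp [mul_assoc] }
  have hΦ : ∀ g x, Φ g x = x * g⁻¹ := fun _ _ => rfl
  refine ⟨(MulEquiv.ofBijective Φ ⟨fun g h hgh => ?_, fun φ => ⟨(φ 1)⁻¹, ?_⟩⟩).symm⟩
  · simpa [hΦ] using congrArg (fun φ : Γ ≃g Γ => φ 1) hgh
  · ext x
    have := hS (φ.toEquiv.trans (Equiv.mulRight (φ 1)⁻¹))
      ⟨by simp, fun x y => by simpa [Γ, mul_assoc] using φ.map_adj_iff (v := x) (w := y)⟩ x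
    simp [mul_inv_eq_iff_eq_mul] at this
    rw [hΦ, this, inv_inv]

end CayleyRigidity

section CommonNeighbours

variable {G : Type*} [Group G] [DecidableEq G]

/-- The number of common neighbours of `1` and `x` in `Cay(G, S)`, plus one if they are adjacent. -/
def commonNeighbours (S : Finset G) (x : G) : ℕ :=
  (∑ s ∈ S, if s * x ∈ S then 1 else 0) + if x ∈ S then 1 else 0

/-- A second-order local invariant of the vertex `x` relative to `1` in `Cay(G, S)`. -/
def localInvariant (S : Finset G) (x : G) : ℕ :=
  ∑ s ∈ S, commonNeighbours S (s * x) ^ 2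

namespace IsCayleyStabilizer

variable {S : Finset G} {f : G ≃ G}

theorem sum_mul_apply {G : Type*} [Group G] {S : Finset G} {f : G ≃ G}
    (hf : IsCayleyStabilizer (S : Set G) f) {c : G → ℕ}
    (hc : ∀ x, c (f x) = c x) (x : G) : ∑ s ∈ S, c (s * f x) = ∑ s ∈ S, c (s * x) := by
  symm
  refine Finset.sum_bij (fun s _ => f (s * x) * (f x)⁻¹) (fun s hs => ?_) (fun s _ t _ h => ?_)
    (fun s hs => ⟨f.symm (s * f x) * x⁻¹, ?_, ?_⟩) (fun s _ => ?_)
  · simpa using (hf.map_mem_iff (s * x) x).2 (by simpa using hs)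
  · simpa using h
  · simpa using (hf.symm.map_mem_iff (s * f x) (f x)).2 (by simpa using hs)
  · simp
  · simp [hc]

theorem commonNeighbours_apply (hf : IsCayleyStabilizer (S : Set G) f) (x : G) :
    commonNeighbours S (f x) = commonNeighbours S x := by
  have hS : ∀ x, f x ∈ S ↔ x ∈ S := fun x => by simpa using hf.mem_iff x
  have := hf.sum_mul_apply (c := fun x => if x ∈ S then 1 else 0) (by simp [hS]) x
  simp only [commonNeighbours, this, hS]

theorem localInvariant_apply (hf : IsCayleyStabilizer (S : Set G) f) (x : G) :
    localInvariant S (f x) = localInvariant S x :=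
  hf.sum_mul_apply (c := fun x => commonNeighbours S x ^ 2)
    (fun x => by rw [hf.commonNeighbours_apply]) x

end IsCayleyStabilizer

theorem isCayleyRigid_of_localInvariant {S T : Finset G}
    (hT : Subgroup.closure (T : Set G) = ⊤) (hTS : T ⊆ S)
    (h : ∀ t ∈ T, ∀ s ∈ S, localInvariant S s = localInvariant S t → s = t) :
    IsCayleyRigid (S : Set G) :=
  isCayleyRigid_of_closure_eq_top hT fun _ hf t ht =>
    h t ht _ ((hf.mem_iff t).2 (hTS ht)) (hf.localInvariant_apply t)

end CommonNeighbours

/-- The generalised dihedral group over an additive abelian group `A`, with rotations `r a` and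
reflections `sr a`. -/
inductive GenDihedral (A : Type*) : Type _
  | r : A → GenDihedral A
  | sr : A → GenDihedral A

namespace GenDihedral

variable {A : Type*}

/-- Rotations and reflections are indexed by two copies of `A`. -/
def equivSum : GenDihedral A ≃ A ⊕ A where
  toFun
    | r a => .inl a
    | sr a => .inr a
  invFun
    | .inl a => r a
    | .inr a => sr a
  left_inv x := by cases x <;> rfl
  right_inv x := by cases x <;> rfl

instance [DecidableEq A] : DecidableEq (GenDihedral A) := equivSum.decidableEq

instance [Finite A] : Finite (GenDihedral A) := Finite.of_equiv _ equivSum.symm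

theorem nat_card [Finite A] : Nat.card (GenDihedral A) = 2 * Nat.card A := by
  rw [Nat.card_congr equivSum, Nat.card_sum, two_mul]

variable [AddCommGroup A]

instance : Group (GenDihedral A) where
  mul
    | r a, r b => r (a + b)
    | r a, sr b => sr (b - a)
    | sr a, r b => sr (a + b)
    | sr a, sr b => r (b - a)
  one := r 0
  inv
    | r a => r (-a)
    | sr a => sr a
  mul_assoc := by
    rintro (a | a) (b | b) (c | c)
    · exact congrArg r (by abel)
    · exact congrArg sr (by abel)
    · exact congrArg sr (by abel)
    · exact congrArg r (by abel)
    · exact congrArg sr (by abel)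
    · exact congrArg r (by abel)
    · exact congrArg r (by abel)
    · exact congrArg sr (by abel)
  one_mul := by
    rintro (a | a)
    · exact congrArg r (by abel)
    · exact congrArg sr (by abel)
  mul_one := by
    rintro (a | a)
    · exact congrArg r (by abel)
    · exact congrArg sr (by abel)
  inv_mul_cancel := by
    rintro (a | a)
    · exact congrArg r (by abel)
    · exact congrArg r (by abel)

@[simp] theorem r_mul_r (a b : A) : r a * r b = r (a + b) := rfl
@[simp] theorem r_mul_sr (a b : A) : r a * sr b = sr (b - a) := rfl
@[simp] theorem sr_mul_r (a b : A) : sr a * r b = sr (a + b) := rfl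
@[simp] theorem sr_mul_sr (a b : A) : sr a * sr b = r (b - a) := rfl
@[simp] theorem inv_r (a : A) : (r a)⁻¹ = r (-a) := rfl
@[simp] theorem inv_sr (a : A) : (sr a)⁻¹ = sr a := rfl
theorem one_def : (1 : GenDihedral A) = r 0 := rfl

theorem closure_involutions : Subgroup.closure {t : GenDihedral A | t * t = 1} = ⊤ := by
  have h : ∀ a : A, sr a ∈ Subgroup.closure {t : GenDihedral A | t * t = 1} := fun a =>
    Subgroup.subset_closure (by simp [one_def])
  refine eq_top_iff.2 fun x _ => ?_
  rcases x with a | a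
  · simpa using mul_mem (h 0) (h a)
  · exact h a

/-- The homomorphism of generalised dihedral groups induced by a homomorphism of the bases. -/
def map {B : Type*} [AddCommGroup B] (φ : A →+ B) : GenDihedral A →* GenDihedral B where
  toFun
    | r a => r (φ a)
    | sr a => sr (φ a)
  map_one' := congrArg r (map_zero φ)
  map_mul' := by rintro (a | a) (b | b) <;> simp

theorem map_injective {B : Type*} [AddCommGroup B] {φ : A →+ B} (hφ : Function.Injective φ) :
    Function.Injective (map φ) := by
  rintro (a | a) (b | b) h
  · exact congrArg r (hφ (r.inj h))
  · cases h
  · cases h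
  · exact congrArg sr (hφ (sr.inj h))

theorem hasTriangleGRR_of_injective {B : Type*} [AddCommGroup B] [Finite B] {φ : A →+ B}
    (hφ : Function.Injective φ) (hA : HasTriangleGRR (GenDihedral A)) :
    HasTriangleGRR (GenDihedral B) :=
  .of_subgroup_of_closure_involutions closure_involutions
    (hA.of_mulEquiv (MonoidHom.ofInjective (map_injective hφ)))

theorem closure_eq_top {T : Set (GenDihedral A)} {a₀ : A} (h0 : sr a₀ ∈ T)
    (h : ∀ P : AddSubgroup A, (∀ a, r a ∈ Subgroup.closure T → a ∈ P) →
      (∀ a, sr a ∈ T → a - a₀ ∈ P) → P = ⊤) : Subgroup.closure T = ⊤ := by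
  let P : AddSubgroup A :=
    { carrier := {a | r a ∈ Subgroup.closure T}
      zero_mem' := (one_mem _ : 1 ∈ Subgroup.closure T)
      add_mem' := fun {a b} (ha : r a ∈ _) (hb : r b ∈ _) =>
        (mul_mem ha hb : r a * r b ∈ Subgroup.closure T)
      neg_mem' := fun {a} (ha : r a ∈ _) => (inv_mem ha : (r a)⁻¹ ∈ Subgroup.closure T) }
  have hs : ∀ {x}, x ∈ T → x ∈ Subgroup.closure T := fun hx => Subgroup.subset_closure hx
  have hP : P = ⊤ := h P (fun _ h => h) fun a ha =>
    (mul_mem (hs h0) (hs ha) : sr a₀ * sr a ∈ Subgroup.closure T)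
  have hr : ∀ a, r a ∈ Subgroup.closure T := fun a => (hP ▸ AddSubgroup.mem_top a : a ∈ P)
  refine eq_top_iff.2 fun x _ => ?_
  rcases x with a | a
  · exact hr a
  · simpa using mul_mem (hs h0) (hr (a - a₀))

section SparseSets

theorem hasTriangleGRR_of_localInvariant [DecidableEq A] [Finite A] {S T : Finset (GenDihedral A)}
    {a₀ : A} (hT : T ⊆ S) (h0 : sr a₀ ∈ T)
    (hgen : ∀ P : AddSubgroup A, (∀ a, sr a ∈ T → a - a₀ ∈ P) → P = ⊤)
    (h1 : 1 ∉ S) (hinv : ∀ s ∈ S, s⁻¹ ∈ S) (h2 : 2 ≤ S.card) (hcard : S.card + 2 ≤ Nat.card A)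
    (h : ∀ t ∈ T, ∀ s ∈ S, localInvariant S s = localInvariant S t → s = t) :
    HasTriangleGRR (GenDihedral A) :=
  .of_sparse (S := (S : Set (GenDihedral A))) (by simpa using h1) (by simpa using hinv)
    (isCayleyRigid_of_localInvariant
      (closure_eq_top (a₀ := a₀) (by simpa using h0) fun P _ hP => hgen P (by simpa using hP)) hT h)
    (by simpa using h2) (by rw [Set.ncard_coe_finset, nat_card]; omega)

theorem hasTriangleGRR_zmod_four_two : HasTriangleGRR (GenDihedral (ZMod 4 × ZMod 2)) := by
  refine hasTriangleGRR_of_localInvariant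
    (S := {r (2, 1), sr (0, 0), sr (0, 1), sr (1, 0), sr (2, 1)})
    (T := {sr (0, 0), sr (0, 1), sr (1, 0)}) (a₀ := (0, 0))
    (by decide) (by decide) (fun P hP => (AddSubgroup.eq_top_iff' P).2 fun a => ?_) (by decide)
    (by decide)
    (by decide) (by rw [Nat.card_eq_fintype_card]; decide) (by decide +kernel)
  have ha : a = a.1.val • ((1, 0) - (0, 0)) + a.2.val • ((0, 1) - (0, 0)) := by
    clear hP; revert a; decide
  rw [ha]
  exact add_mem (nsmul_mem (hP _ (by decide)) _) (nsmul_mem (hP _ (by decide)) _)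

theorem hasTriangleGRR_zmod_five_five : HasTriangleGRR (GenDihedral (ZMod 5 × ZMod 5)) := by
  refine hasTriangleGRR_of_localInvariant
    (S := {sr (0, 0), sr (0, 1), sr (0, 2), sr (1, 0), sr (2, 3), sr (4, 3)})
    (T := {sr (0, 0), sr (0, 1), sr (1, 0)}) (a₀ := (0, 0))
    (by decide) (by decide) (fun P hP => (AddSubgroup.eq_top_iff' P).2 fun a => ?_) (by decide)
    (by decide)
    (by decide) (by rw [Nat.card_eq_fintype_card]; decide) (by decide +kernel)
  have ha : a = a.1.val • ((1, 0) - (0, 0)) + a.2.val • ((0, 1) - (0, 0)) := by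
    clear hP; revert a; decide
  rw [ha]
  exact add_mem (nsmul_mem (hP _ (by decide)) _) (nsmul_mem (hP _ (by decide)) _)

theorem hasTriangleGRR_zmod_three_three_three :
    HasTriangleGRR (GenDihedral (ZMod 3 × ZMod 3 × ZMod 3)) := by
  refine hasTriangleGRR_of_localInvariant
    (S := {sr (0, 0, 0), sr (0, 0, 1), sr (0, 1, 0), sr (1, 0, 0), sr (1, 1, 2), sr (2, 1, 2),
      sr (2, 2, 0), sr (2, 2, 1)})
    (T := {sr (0, 0, 0), sr (0, 0, 1), sr (0, 1, 0), sr (1, 0, 0)}) (a₀ := (0, 0, 0))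
    (by decide) (by decide) (fun P hP => (AddSubgroup.eq_top_iff' P).2 fun a => ?_) (by decide)
    (by decide)
    (by decide) (by rw [Nat.card_eq_fintype_card]; decide) (by decide +kernel)
  have ha : a = a.1.val • ((1, 0, 0) - (0, 0, 0)) + a.2.1.val • ((0, 1, 0) - (0, 0, 0)) +
      a.2.2.val • ((0, 0, 1) - (0, 0, 0)) := by
    clear hP; revert a; decide
  rw [ha]
  exact add_mem (add_mem (nsmul_mem (hP _ (by decide)) _) (nsmul_mem (hP _ (by decide)) _))
    (nsmul_mem (hP _ (by decide)) _)

theorem hasTriangleGRR_zmod_two_two_two_two :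
    HasTriangleGRR (GenDihedral (ZMod 2 × ZMod 2 × ZMod 2 × ZMod 2)) := by
  refine hasTriangleGRR_of_localInvariant
    (S := {r (0, 0, 1, 0), r (0, 1, 1, 0), r (1, 1, 1, 1), sr (0, 0, 0, 0), sr (0, 0, 0, 1),
      sr (0, 0, 1, 0), sr (0, 0, 1, 1), sr (0, 1, 0, 0), sr (0, 1, 1, 1), sr (1, 0, 0, 0),
      sr (1, 0, 1, 1), sr (1, 1, 0, 1)})
    (T := {sr (0, 0, 0, 0), sr (0, 0, 0, 1), sr (0, 0, 1, 0), sr (0, 1, 0, 0), sr (1, 0, 0, 0)})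
    (a₀ := (0, 0, 0, 0))
    (by decide) (by decide) (fun P hP => (AddSubgroup.eq_top_iff' P).2 fun a => ?_) (by decide)
    (by decide)
    (by decide) (by rw [Nat.card_eq_fintype_card]; decide) (by decide +kernel)
  have ha : a = a.1.val • ((1, 0, 0, 0) - (0, 0, 0, 0)) +
      a.2.1.val • ((0, 1, 0, 0) - (0, 0, 0, 0)) + a.2.2.1.val • ((0, 0, 1, 0) - (0, 0, 0, 0)) +
      a.2.2.2.val • ((0, 0, 0, 1) - (0, 0, 0, 0)) := by
    clear hP; revert a; decide
  rw [ha]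
  exact add_mem (add_mem (add_mem (nsmul_mem (hP _ (by decide)) _) (nsmul_mem (hP _ (by decide)) _))
    (nsmul_mem (hP _ (by decide)) _)) (nsmul_mem (hP _ (by decide)) _)

theorem hasTriangleGRR_zmod_six : HasTriangleGRR (GenDihedral (ZMod 6)) := by
  let S : Finset (GenDihedral (ZMod 6)) := {r 2, r 3, r 4, sr 1, sr 2, sr 4}
  let T : Finset (GenDihedral (ZMod 6)) := {r 3, sr 2, sr 4}
  have hTS : T ⊆ S := by decide
  have hT : Subgroup.closure (T : Set (GenDihedral (ZMod 6))) = ⊤ := by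
    refine closure_eq_top (a₀ := 2) (by simp [T]) fun P hP hP' => (AddSubgroup.eq_top_iff' P).2
      fun a => ?_
    have h3 : (3 : ZMod 6) ∈ P := hP 3 (Subgroup.subset_closure (by simp [T]))
    have ha : ∀ a : ZMod 6, a = a.val • (3 - (4 - 2)) := by decide
    rw [ha a]
    exact nsmul_mem (sub_mem h3 (hP' 4 (by simp [T]))) _
  refine ⟨S, by decide, by decide, ?_, ?_, ?_, ?_, ?_⟩
  · exact isCayleyRigid_of_localInvariant hT hTS (by decide +kernel)
  · decide
  · exact eq_top_iff.2 (hT ▸ Subgroup.closure_mono (by exact_mod_cast hTS))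
  · rw [Set.ncard_coe_finset]; decide
  · rw [Set.ncard_coe_finset, nat_card, Nat.card_zmod]; decide

theorem hasTriangleGRR_zmod_of_seven_le {n : ℕ} (hn : 7 ≤ n) :
    HasTriangleGRR (GenDihedral (ZMod n)) := by
  have : NeZero n := ⟨by omega⟩
  have hne : ∀ k : ℕ, 0 < k → k < 7 → (k : ZMod n) ≠ 0 := fun k h0 h7 h =>
    absurd (Nat.le_of_dvd h0 ((ZMod.natCast_eq_zero_iff k n).1 h)) (by omega)
  obtain ⟨e, he⟩ : ∃ e : ZMod n, e = 1 := ⟨_, rfl⟩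
  have n1 : e ≠ 0 := by simpa [he] using hne 1 (by simp) (by simp)
  have n2 : 2 * e ≠ 0 := by simpa [he] using hne 2 (by simp) (by simp)
  have n3 : 3 * e ≠ 0 := by simpa [he] using hne 3 (by simp) (by simp)
  have n4 : 4 * e ≠ 0 := by simpa [he] using hne 4 (by simp) (by simp)
  have n5 : 5 * e ≠ 0 := by simpa [he] using hne 5 (by simp) (by simp)
  have n6 : 6 * e ≠ 0 := by simpa [he] using hne 6 (by simp) (by simp)
  have hval : ∀ a : ZMod n, a.val • e = a := by simp [he]
  clear he
  let S : Set (GenDihedral (ZMod n)) := {r e, r (-e), sr 0, sr e, sr (3 * e)}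
  have hr : ∀ a, r a ∈ S ↔ a = e ∨ a = -e := fun a => by simp [S]
  have hsr : ∀ a, sr a ∈ S ↔ a = 0 ∨ a = e ∨ a = 3 * e := fun a => by simp [S]
  have hcard : S.ncard = 5 := by
    have e1 : e ≠ -e := by grind
    have e2 : 0 ≠ e := n1.symm
    have e3 : 0 ≠ 3 * e := n3.symm
    have e4 : e ≠ 3 * e := by grind
    simp only [S]
    repeat rw [Set.ncard_insert_of_notMem (by simp [*])]
    simp
  clear_value S
  have pair : ∀ u v w, u ∈ S → v ∈ S → w ∈ S → v ≠ w → v * u⁻¹ ∈ S → w * u⁻¹ ∈ S →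
      u = sr 0 ∨ u = sr e := by
    rintro (u | u) (v | v) (w | w) <;>
      simp only [inv_sr, inv_r, sr_mul_r, sr_mul_sr, r_mul_r, r_mul_sr, hr, hsr, ne_eq,
        r.injEq, sr.injEq, reduceCtorEq] <;> clear hr hsr hcard hval hne <;> grind
  have isolated : ∀ v ∈ S, v * (sr (3 * e))⁻¹ ∉ S := by
    rintro (v | v) <;>
      simp only [inv_sr, r_mul_sr, sr_mul_sr, hr, hsr] <;> clear hr hsr hcard hval hne <;> grind
  have not_isolated : ∀ u ∈ S, sr 0 * u⁻¹ ∉ S → sr e * u⁻¹ ∉ S → u = sr (3 * e) := by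
    rintro (u | u) <;>
      simp only [inv_sr, inv_r, sr_mul_r, sr_mul_sr, hr, hsr, reduceCtorEq, sr.injEq] <;>
      clear hr hsr hcard hval hne <;> grind
  have separated : ∀ z, z * (sr 0)⁻¹ ∈ S → z * (sr (3 * e))⁻¹ ∈ S → z = 1 := by
    rintro (z | z) <;>
      simp only [inv_sr, r_mul_sr, sr_mul_sr, hr, hsr, zero_sub, neg_eq_zero, one_def, r.injEq,
        reduceCtorEq] <;> clear hr hsr hcard hval hne
    · have h5 : -z = 3 * e → 3 * e - z ≠ e := fun h h' => n5 (by linear_combination h' - h)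
      grind
    · grind
  refine .of_sparse (S := S) ?_ ?_ ?_ (by omega) ?_
  · rw [one_def, hr]
    grind
  · rintro (a | a) h
    · simp only [inv_r, hr] at h ⊢
      grind
    · simpa using h
  · have hT : Subgroup.closure ({sr 0, sr e} : Set (GenDihedral (ZMod n))) = ⊤ := by
      refine closure_eq_top (a₀ := 0) (by simp) fun P _ hP => eq_top_iff.2 fun a _ => ?_
      have := nsmul_mem (hP e (by simp)) a.val
      simpa [hval] using this
    refine isCayleyRigid_of_closure_eq_top hT fun f hf => ?_
    have h3 : f (sr (3 * e)) = sr (3 * e) := by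
      have hno : ∀ v ∈ S, v * (f (sr (3 * e)))⁻¹ ∉ S := fun v hv h =>
        isolated (f.symm v) ((hf.symm.mem_iff v).2 hv)
          (by simpa using (hf.symm.map_mem_iff v (f (sr (3 * e)))).2 h)
      exact not_isolated _ ((hf.mem_iff _).2 (by simp [hsr])) (hno _ (by simp [hsr]))
        (hno _ (by simp [hsr]))
    have hpair : ∀ u v w, u ∈ S → v ∈ S → w ∈ S → v ≠ w → v * u⁻¹ ∈ S → w * u⁻¹ ∈ S →
        f u = sr 0 ∨ f u = sr e := fun u v w hu hv hw hvw hvu hwu =>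
      pair (f u) (f v) (f w) ((hf.mem_iff _).2 hu) ((hf.mem_iff _).2 hv) ((hf.mem_iff _).2 hw)
        (f.injective.ne hvw) ((hf.map_mem_iff _ _).2 hvu) ((hf.map_mem_iff _ _).2 hwu)
    have h1 : f (sr e) = sr e := by
      refine (hpair (sr e) (sr 0) (r e) ?_ ?_ ?_ ?_ ?_ ?_).resolve_left fun h0 => ?_
      any_goals simp [hr, hsr]
      have hz1 := (hf.map_mem_iff (sr (2 * e)) (sr e)).2 (by simp [hr]; grind)
      have hz3 := (hf.map_mem_iff (sr (2 * e)) (sr (3 * e))).2 (by simp [hr]; grind)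
      rw [h0] at hz1
      rw [h3] at hz3
      have hz := separated _ hz1 hz3
      rw [← hf.map_one, f.injective.eq_iff] at hz
      cases hz
    have h0 : f (sr 0) = sr 0 := by
      refine (hpair (sr 0) (sr e) (r (-e)) ?_ ?_ ?_ ?_ ?_ ?_).resolve_right fun h => ?_
      any_goals simp [hr, hsr]
      rw [← h1, f.injective.eq_iff, sr.injEq] at h
      exact n1 h.symm
    rintro t (rfl | rfl)
    · exact h0
    · exact h1
  · rw [hcard, nat_card, Nat.card_zmod]
    omega

end SparseSets

end GenDihedral

section Embeddings

variable {A : Type*} [AddCommGroup A]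

theorem exists_zmod_addOrderOf_injective (a : A) :
    ∃ φ : ZMod (addOrderOf a) →+ A, Function.Injective φ ∧ φ 1 = a := by
  refine ⟨ZMod.lift (addOrderOf a) ⟨zmultiplesHom A a, by simp [addOrderOf_nsmul_eq_zero]⟩, ?_, ?_⟩
  · rw [ZMod.lift_injective]
    intro m hm
    rw [ZMod.intCast_zmod_eq_zero_iff_dvd]
    exact addOrderOf_dvd_iff_zsmul_eq_zero.2 (by simpa using hm)
  · rw [← Int.cast_one, ZMod.lift_coe]
    simp

theorem exists_natCard_eq_prime_pow {p : ℕ} [Fact p.Prime] [Finite A] (hA : ∀ a : A, p • a = 0) :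
    ∃ d, Nat.card A = p ^ d := by
  have : Module (ZMod p) A := AddCommGroup.zmodModule hA
  exact ⟨_, by simpa using Module.natCard_eq_pow_finrank (K := ZMod p) (V := A)⟩

theorem exists_addMonoidHom_injective {p : ℕ} [Fact p.Prime] {V : Type*} [AddCommGroup V]
    [Finite V] [Finite A] (hV : ∀ v : V, p • v = 0) (hA : ∀ a : A, p • a = 0)
    (h : Nat.card V ≤ Nat.card A) : ∃ φ : V →+ A, Function.Injective φ := by
  have : Module (ZMod p) V := AddCommGroup.zmodModule hV
  have : Module (ZMod p) A := AddCommGroup.zmodModule hA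
  have hcV : Nat.card V = p ^ Module.finrank (ZMod p) V := by
    simpa using Module.natCard_eq_pow_finrank (K := ZMod p) (V := V)
  have hcA : Nat.card A = p ^ Module.finrank (ZMod p) A := by
    simpa using Module.natCard_eq_pow_finrank (K := ZMod p) (V := A)
  rw [hcV, hcA, Nat.pow_le_pow_iff_right (Fact.out : p.Prime).one_lt] at h
  obtain ⟨f, hf⟩ := (finrank_le_iff_exists_linearMap (R := ZMod p) (M := V) (M' := A)).1 h
  exact ⟨f.toAddMonoidHom, hf⟩

theorem exists_zmod_four_two_injective (hA : ∀ a : A, 4 • a = 0) {a y : A}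
    (ha : addOrderOf a = 4) (hy : y ∉ AddSubgroup.zmultiples a) :
    ∃ φ : ZMod 4 × ZMod 2 →+ A, Function.Injective φ := by
  obtain ⟨z, hz2, hz⟩ : ∃ z, 2 • z = 0 ∧ z ∉ AddSubgroup.zmultiples a := by
    by_cases h2 : 2 • y ∈ AddSubgroup.zmultiples a
    · obtain ⟨m, hm⟩ := AddSubgroup.mem_zmultiples_iff.1 h2
      have h4 : (2 * m) • a = 0 := by
        rw [mul_smul, hm, ← natCast_zsmul y, smul_smul]
        exact_mod_cast hA y
      have hdvd : (4 : ℤ) ∣ 2 * m := by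
        exact_mod_cast ha ▸ addOrderOf_dvd_iff_zsmul_eq_zero.2 h4
      obtain ⟨l, rfl⟩ : ∃ l, m = 2 * l := ⟨m / 2, by omega⟩
      refine ⟨y - l • a, ?_, fun h => hy ?_⟩
      · rw [smul_sub, ← hm, mul_smul]
        simp [two_smul]
      · simpa using add_mem h (AddSubgroup.zsmul_mem_zmultiples a l)
    · exact ⟨2 • y, by rw [smul_smul]; exact hA y, h2⟩
  obtain ⟨φ, hφ, hφ1⟩ := ha ▸ exists_zmod_addOrderOf_injective a
  have hz' : addOrderOf z = 2 := addOrderOf_eq_prime hz2 (by rintro rfl; exact hz (zero_mem _))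
  obtain ⟨ψ, hψ, hψ1⟩ := hz' ▸ exists_zmod_addOrderOf_injective z
  have hφmem : ∀ u, φ u ∈ AddSubgroup.zmultiples a := fun u => by
    rw [← ZMod.natCast_zmod_val u, ← nsmul_one, map_nsmul, hφ1]
    exact AddSubgroup.nsmul_mem_zmultiples a _
  refine ⟨φ.coprod ψ, (injective_iff_map_eq_zero _).2 ?_⟩
  rintro ⟨u, v⟩ h
  rw [AddMonoidHom.coprod_apply] at h
  have hv : v = 0 := by
    by_contra hv
    obtain rfl : v = 1 := by clear h; revert v; decide
    exact hz (by simpa [← hψ1, eq_neg_of_add_eq_zero_right h] using hφmem u)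
  subst hv
  simpa [map_eq_zero_iff φ hφ] using h

end Embeddings

namespace GenDihedral

variable {A : Type*} [AddCommGroup A] [Finite A]

theorem hasTriangleGRR_of_six_le_addOrderOf {a : A} (ha : 6 ≤ addOrderOf a) :
    HasTriangleGRR (GenDihedral A) := by
  obtain ⟨φ, hφ, -⟩ := exists_zmod_addOrderOf_injective a
  refine hasTriangleGRR_of_injective hφ ?_
  rcases ha.eq_or_lt with h | h
  · exact h ▸ hasTriangleGRR_zmod_six
  · exact hasTriangleGRR_zmod_of_seven_le h

theorem hasTriangleGRR (h6 : 6 ≤ Nat.card A) (h9 : Nat.card A ≠ 9)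
    (h8 : Nat.card A = 8 → ¬ ∀ a : A, 2 • a = 0) : HasTriangleGRR (GenDihedral A) := by
  obtain ⟨a, ha⟩ := AddMonoid.exists_addOrderOf_eq_exponent
    (AddMonoid.ExponentExists.of_finite (G := A))
  rcases Nat.lt_or_ge (addOrderOf a) 6 with hlt | hge
  swap
  · exact hasTriangleGRR_of_six_le_addOrderOf hge
  have hexp : ∀ x : A, addOrderOf a • x = 0 := ha ▸ AddMonoid.exponent_nsmul_eq_zero
  have hpos := addOrderOf_pos a
  generalize hn : addOrderOf a = n at hlt hexp hpos
  interval_cases n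
  · have : Subsingleton A := ⟨fun x y => by rw [← one_smul ℕ x, hexp, ← one_smul ℕ y, hexp]⟩
    simp at h6
  · obtain ⟨d, hd⟩ := exists_natCard_eq_prime_pow hexp
    have h16 : 2 ^ 4 ≤ 2 ^ d := Nat.pow_le_pow_right (by simp) (by
      by_contra! hd4
      interval_cases d <;> simp_all)
    obtain ⟨φ, hφ⟩ := exists_addMonoidHom_injective (p := 2) (A := A)
      (V := ZMod 2 × ZMod 2 × ZMod 2 × ZMod 2) (by decide) hexp (by simpa [hd] using h16)
    exact hasTriangleGRR_of_injective hφ hasTriangleGRR_zmod_two_two_two_two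
  · obtain ⟨d, hd⟩ := exists_natCard_eq_prime_pow hexp
    have h27 : 3 ^ 3 ≤ 3 ^ d := Nat.pow_le_pow_right (by simp) (by
      by_contra! hd3
      interval_cases d <;> simp_all)
    obtain ⟨φ, hφ⟩ := exists_addMonoidHom_injective (p := 3) (A := A)
      (V := ZMod 3 × ZMod 3 × ZMod 3) (by decide) hexp (by simpa [hd] using h27)
    exact hasTriangleGRR_of_injective hφ hasTriangleGRR_zmod_three_three_three
  · obtain ⟨y, hy⟩ : ∃ y, y ∉ AddSubgroup.zmultiples a := by
      by_contra! h
      have := Nat.card_zmultiples a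
      rw [(AddSubgroup.eq_top_iff' _).2 h, hn, AddSubgroup.card_top] at this
      omega
    obtain ⟨φ, hφ⟩ := exists_zmod_four_two_injective hexp hn hy
    exact hasTriangleGRR_of_injective hφ hasTriangleGRR_zmod_four_two
  · have h5 : ∀ v : ZMod 5 × ZMod 5, 5 • v = 0 := by decide
    have : Fact (Nat.Prime 5) := ⟨Nat.prime_five⟩
    obtain ⟨d, hd⟩ := exists_natCard_eq_prime_pow hexp
    have h25 : 5 ^ 2 ≤ 5 ^ d := Nat.pow_le_pow_right (by simp) (by
      by_contra! hd2
      interval_cases d <;> simp_all)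
    obtain ⟨φ, hφ⟩ := exists_addMonoidHom_injective (p := 5) (A := A)
      (V := ZMod 5 × ZMod 5) h5 hexp (by simpa [hd] using h25)
    exact hasTriangleGRR_of_injective hφ hasTriangleGRR_zmod_five_five

end GenDihedral

universe u

section Classification

theorem IsGeneralizedDihedral.exists_mulEquiv {G : Type u} [Group G] (h : IsGeneralizedDihedral G) :
    ∃ (A : Type u) (_ : AddCommGroup A), Nonempty (GenDihedral A ≃* G) := by
  obtain ⟨X, b, hX, hcomm, hb, hb2, hinv⟩ := h
  let : CommGroup X :=
    { (inferInstance : Group X) with mul_comm := fun x y => Subtype.ext (hcomm x x.2 y y.2) }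
  have hbb : b * b = 1 := by rwa [← sq]
  have hab : ∀ x : X, (x : G) * b = b * (x : G)⁻¹ := fun x => by
    rw [← hinv x x.2, inv_eq_of_mul_eq_one_left hbb, ← mul_assoc, ← mul_assoc, hbb, one_mul]
  let Φ : GenDihedral (Additive X) →* G :=
    { toFun
        | .r a => (a.toMul : G)
        | .sr a => b * (a.toMul : G)
      map_one' := rfl
      map_mul' := by
        rintro (x | x) (y | y)
        · exact X.coe_mul x.toMul y.toMul
        · change b * ((y.toMul / x.toMul : X) : G) = x.toMul * (b * y.toMul)
          rw [div_eq_mul_inv, mul_comm y.toMul, ← mul_assoc, hab, X.coe_mul, X.coe_inv, mul_assoc]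
        · exact (mul_assoc b (x.toMul : G) y.toMul).symm
        · change ((y.toMul / x.toMul : X) : G) = b * x.toMul * (b * y.toMul)
          rw [div_eq_mul_inv, mul_comm y.toMul, mul_assoc, ← mul_assoc (x.toMul : G), hab,
            mul_assoc b, ← mul_assoc b,
            hbb, one_mul, X.coe_mul, X.coe_inv] }
  refine ⟨Additive X, inferInstance, ⟨MulEquiv.ofBijective Φ ⟨?_, fun g => ?_⟩⟩⟩
  · rw [injective_iff_map_eq_one]
    rintro (x | x) h
    · exact congrArg GenDihedral.r (Subtype.ext h : x.toMul = 1)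
    · exact absurd (eq_inv_of_mul_eq_one_left h ▸ X.inv_mem x.toMul.2) hb
  · by_cases hg : g ∈ X
    · exact ⟨.r (.ofMul ⟨g, hg⟩), rfl⟩
    · exact ⟨.sr (.ofMul ⟨b * g, (Subgroup.mul_mem_iff_of_index_two hX).2 (by simp [hb, hg])⟩),
        show b * (b * g) = g by rw [← mul_assoc, hbb, one_mul]⟩

theorem nonempty_mulEquiv_of_mul_self_eq_one {G : Type*} [Group G] [Finite G]
    (h16 : Nat.card G = 16) (h : ∀ g : G, g * g = 1) :
    Nonempty (G ≃* Multiplicative (ZMod 2 × ZMod 2 × ZMod 2 × ZMod 2)) := by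
  have hinv : ∀ g : G, g⁻¹ = g := fun g => inv_eq_of_mul_eq_one_left (h g)
  let : CommGroup G :=
    { (inferInstance : Group G) with
      mul_comm := fun x y => by rw [← hinv (x * y), mul_inv_rev, hinv, hinv] }
  have hc : Nat.card (ZMod 2 × ZMod 2 × ZMod 2 × ZMod 2) = Nat.card (Additive G) := by
    rw [Nat.card_congr Additive.toMul, h16]
    simp
  obtain ⟨φ, hφ⟩ := exists_addMonoidHom_injective (p := 2) (A := Additive G)
    (V := ZMod 2 × ZMod 2 × ZMod 2 × ZMod 2) (by decide)
    (fun g => by rw [two_smul]; exact h g.toMul) hc.le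
  have hbij := hφ.bijective_of_nat_card_le hc.ge
  exact ⟨(AddEquiv.ofBijective φ hbij).toMultiplicativeLeft.symm⟩

end Classification

/-- Lemma: a generalised dihedral group of order `2k` with `k ≥ 6`, `k ≠ 9`,
not isomorphic to `C₂ × C₂ × C₂ × C₂`, admits a graphical regular
representation: a Cayley graph `Cay(G, S)` whose automorphism group is
isomorphic to `G`. -/
theorem generalizedDihedral_has_GRR (G : Type*) [Group G] [Finite G] (k : ℕ)
    (hk6 : 6 ≤ k) (hk9 : k ≠ 9) (hcard : Nat.card G = 2 * k)
    (hdih : IsGeneralizedDihedral G)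
    (hnot : ¬ Nonempty (G ≃* Multiplicative (ZMod 2 × ZMod 2 × ZMod 2 × ZMod 2))) :
    ∃ S : Set G, (1 : G) ∉ S ∧ (∀ s ∈ S, s⁻¹ ∈ S) ∧
      ∃ Γ : SimpleGraph G, (∀ x y : G, Γ.Adj x y ↔ x * y⁻¹ ∈ S) ∧
        Nonempty ((Γ ≃g Γ) ≃* G) := by
  obtain ⟨A, _, ⟨e⟩⟩ := hdih.exists_mulEquiv
  have : Finite A := Finite.of_injective (fun a => e (.r a)) fun a b h => by simpa using h
  have hA : Nat.card A = k := by
    have := Nat.card_congr e.toEquiv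
    rw [GenDihedral.nat_card, hcard] at this
    omega
  refine ((GenDihedral.hasTriangleGRR (hA ▸ hk6) (hA ▸ hk9) fun h8 h => ?_).of_mulEquiv
    e).exists_cayleyGraph
  refine hnot (nonempty_mulEquiv_of_mul_self_eq_one (by omega) fun g => ?_)
  obtain ⟨x, rfl⟩ := e.surjective g
  rw [← map_mul, ← map_one e]
  rcases x with a | a
  · simp [GenDihedral.one_def, ← two_smul ℕ a, h]
  · simp [GenDihedral.one_def]
end
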